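/- Let $0 < r < p \le q < 1$, and let $u, v, w$ be weights on $(a,b)$ with $0 < \int_x^b w < \infty$ for all $x \in (a,b)$. Then the inequality $\big(\int_a^b \big(\int_a^t f^r v\big)^{q/r} u\,dt\big)^{1/q} \le C \big(\int_a^b \big(\int_a^t f\big)^{p} w\,dt\big)^{1/p}$ holds for all nonnegative measurable $f$ if and only if both $C_2 := \sup_{x\in(a,b)} \big(\int_x^b w\big)^{-1/p} \big(\int_x^b \big(\int_t^b u\big)^{q/(1-q)} u(t)\, V_r(x,t)^{q/(1-q)}\, dt\big)^{(1-q)/q}$ and $C_3 := \sup_{x\in(a,b)} \big(\int_x^b u\big)^{1/q} \big(\int_a^x \big(\int_t^b w\big)^{-p/(p-r)} w(t)\, V_r(t,x)^{pr/(p-r)}\, dt\big)^{(p-r)/(pr)}$ are finite; moreover the best constant satisfies $C \approx C_2 + C_3$. -/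

import Mathlib

open MeasureTheory Set ENNReal

noncomputable section

/-- `w` is a weight on `(a,b)`: measurable, positive and finite there. -/
def IsWeight (a b : ℝ) (w : ℝ → ℝ≥0∞) : Prop :=
  Measurable w ∧ ∀ x ∈ Set.Ioo a b, 0 < w x ∧ w x < ∞

/-- The quantity `V_r(x,t)`: `(∫_x^t v^{1/(1-r)})^{(1-r)/r}` for `0 < r < 1`,
and `ess sup_{(x,t)} v` for `r = 1`. -/
def Vr (r : ℝ) (v : ℝ → ℝ≥0∞) (x t : ℝ) : ℝ≥0∞ :=
  if r = 1 then essSup v (volume.restrict (Set.Ioo x t))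
  else (∫⁻ s in Set.Ioo x t, v s ^ (1 / (1 - r))) ^ ((1 - r) / r)

/-- The Cesàro–Cesàro inequality (2.2) with constant `C`:
`(∫_a^b (∫_a^t f^r v)^{q/r} u dt)^{1/q} ≤ C (∫_a^b (∫_a^t f)^p w dt)^{1/p}`
for all nonnegative measurable `f` on `(a,b)`. -/
def CesCesIneq (a b r p q : ℝ) (u v w : ℝ → ℝ≥0∞) (C : ℝ≥0∞) : Prop :=
  ∀ f : ℝ → ℝ≥0∞, Measurable f →
    (∫⁻ t in Set.Ioo a b, (∫⁻ s in Set.Ioo a t, f s ^ r * v s) ^ (q / r) * u t) ^ (1 / q) ≤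
      C * (∫⁻ t in Set.Ioo a b, (∫⁻ s in Set.Ioo a t, f s) ^ p * w t) ^ (1 / p)

/-- The best (least) constant in the Cesàro–Cesàro inequality. -/
def BestC (a b r p q : ℝ) (u v w : ℝ → ℝ≥0∞) : ℝ≥0∞ :=
  sInf {C | CesCesIneq a b r p q u v w C}

def C₁ (a b r p q : ℝ) (u v w : ℝ → ℝ≥0∞) : ℝ≥0∞ :=
  essSup (fun x => (∫⁻ t in Set.Ioo x b, w t) ^ (-(1 / p)) *
      essSup (fun t => (∫⁻ s in Set.Ioo t b, u s) ^ (1 / q) * Vr r v x t)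
        (volume.restrict (Set.Ioo x b)))
    (volume.restrict (Set.Ioo a b))

def C₂ (a b r p q : ℝ) (u v w : ℝ → ℝ≥0∞) : ℝ≥0∞ :=
  ⨆ x ∈ Set.Ioo a b, (∫⁻ t in Set.Ioo x b, w t) ^ (-(1 / p)) *
    (∫⁻ t in Set.Ioo x b,
        (∫⁻ s in Set.Ioo t b, u s) ^ (q / (1 - q)) * u t * Vr r v x t ^ (q / (1 - q))) ^
      ((1 - q) / q)

def C₃ (a b r p q : ℝ) (u v w : ℝ → ℝ≥0∞) : ℝ≥0∞ :=
  ⨆ x ∈ Set.Ioo a b, (∫⁻ t in Set.Ioo x b, u t) ^ (1 / q) *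
    (∫⁻ t in Set.Ioo a x,
        (∫⁻ s in Set.Ioo t b, w s) ^ (-(p / (p - r))) * w t * Vr r v t x ^ (p * r / (p - r))) ^
      ((p - r) / (p * r))

def C₄ (a b r p q : ℝ) (u v w : ℝ → ℝ≥0∞) : ℝ≥0∞ :=
  (∫⁻ x in Set.Ioo a b, (∫⁻ s in Set.Ioo x b, u s) ^ (q / (p - q)) * u x *
      essSup (fun t => (∫⁻ s in Set.Ioo t b, w s) ^ (-(q / (p - q))) *
          Vr r v t x ^ (p * q / (p - q)))
        (volume.restrict (Set.Ioo a x))) ^ ((p - q) / (p * q))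

def C₅ (a b r p q : ℝ) (u v w : ℝ → ℝ≥0∞) : ℝ≥0∞ :=
  (∫⁻ x in Set.Ioo a b, w x *
      ⨆ y ∈ Set.Ioo a x, (∫⁻ s in Set.Ioo y b, w s) ^ (-(p / (p - q))) *
        (∫⁻ t in Set.Ioo y x,
            (∫⁻ s in Set.Ioo t x, u s) ^ (q / (1 - q)) * u t * Vr r v y t ^ (q / (1 - q))) ^
          (p * (1 - q) / (p - q))) ^ ((p - q) / (p * q))

def C₆ (a b r p q : ℝ) (u v w : ℝ → ℝ≥0∞) : ℝ≥0∞ :=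
  (∫⁻ x in Set.Ioo a b, w x *
      essSup (fun y => (∫⁻ s in Set.Ioo y b, w s)⁻¹ *
          (∫⁻ t in Set.Ioo y x, (∫⁻ s in Set.Ioo t b, u s) ^ (q / (p - q)) * u t *
              (∫⁻ s in Set.Ioo a y, (∫⁻ σ in Set.Ioo s b, w σ) ^ (-(p / (p - r))) * w s *
                  Vr r v s y ^ (p * r / (p - r))) ^ ((p - r) * q / ((p - q) * r))))
        (volume.restrict (Set.Ioo a x))) ^ ((p - q) / (p * q))

def C₇ (a b r p q : ℝ) (u v w : ℝ → ℝ≥0∞) : ℝ≥0∞ :=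
  (∫⁻ x in Set.Ioo a b, w x *
      essSup (fun y => (∫⁻ s in Set.Ioo y b, w s) ^ (-(p / (p - q))) *
          essSup (fun t => (∫⁻ s in Set.Ioo t x, u s) ^ (p / (p - q)) *
              Vr r v y t ^ (p * q / (p - q)))
            (volume.restrict (Set.Ioo y x)))
        (volume.restrict (Set.Ioo a x))) ^ ((p - q) / (p * q))

open Filter Topology

lemma continuous_measureReal_Iio (μ : Measure ℝ) [IsFiniteMeasure μ] [NullSingletonClass μ] :
    Continuous fun s => μ.real (Iio s) := by
  rw [continuous_iff_continuousAt]
  intro s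
  have h := IntegrableOn.continuousOn_Iic_primitive_Iio (μ := μ) (f := fun _ => (1 : ℝ))
    (a₀ := s + 1) (integrable_const _).integrableOn
  have h2 := h.continuousAt (Iic_mem_nhds (by linarith : s < s + 1))
  simpa using h2

/-- A finite diffuse measure on the line is pushed to Lebesgue measure by its distribution
function. -/
lemma map_measureReal_Iio (μ : Measure ℝ) [IsFiniteMeasure μ] [NullSingletonClass μ] :
    μ.map (fun s => μ.real (Iio s)) = volume.restrict (Ioc 0 (μ.real univ)) := by
  have hc := continuous_measureReal_Iio μ
  have hmono : Monotone fun s => μ.real (Iio s) := fun s t h =>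
    measureReal_mono (Iio_subset_Iio h)
  refine Measure.ext_of_Iic _ _ fun y => ?_
  rw [Measure.map_apply hc.measurable measurableSet_Iic, Measure.restrict_apply measurableSet_Iic]
  rcases le_or_gt (μ.real univ) y with hy | hy
  · have h1 : (fun s => μ.real (Iio s)) ⁻¹' Iic y = univ := by
      ext s
      simpa using (measureReal_mono (subset_univ _)).trans hy
    have h2 : Iic y ∩ Ioc 0 (μ.real univ) = Ioc 0 (μ.real univ) := by
      ext z
      simp only [mem_inter_iff, mem_Iic, mem_Ioc, and_iff_right_iff_imp]
      exact fun h => h.2.trans hy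
    rw [h1, h2, Real.volume_Ioc, sub_zero, ofReal_measureReal]
  rcases lt_or_ge y 0 with hy0 | hy0
  · have h1 : (fun s => μ.real (Iio s)) ⁻¹' Iic y = ∅ := by
      ext s
      simpa using hy0.trans_le measureReal_nonneg
    have h2 : Iic y ∩ Ioc 0 (μ.real univ) = ∅ := by
      ext z
      simp only [mem_inter_iff, mem_Iic, mem_Ioc, mem_empty_iff_false, iff_false]
      intro h
      linarith [h.1, h.2.1]
    rw [h1, h2]; simp
  have h2 : Iic y ∩ Ioc 0 (μ.real univ) = Ioc 0 y := by
    ext z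
    simp only [mem_inter_iff, mem_Iic, mem_Ioc]
    constructor
    · intro h; exact ⟨h.2.1, h.1⟩
    · intro h; exact ⟨h.2, h.1, h.2.trans hy.le⟩
  rw [h2, Real.volume_Ioc, sub_zero]
  set T := (fun s => μ.real (Iio s)) ⁻¹' Iic y with hT
  have htop : ∃ s, y < μ.real (Iio s) := by
    have h1 : Tendsto (fun s => μ (Iic s)) atTop (𝓝 (μ univ)) := tendsto_measure_Iic_atTop μ
    have h2 : Tendsto (fun s => μ.real (Iic s)) atTop (𝓝 (μ.real univ)) :=
      (ENNReal.tendsto_toReal (measure_ne_top μ univ)).comp h1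
    obtain ⟨s, hs⟩ := (h2.eventually (lt_mem_nhds hy)).exists
    refine ⟨s, ?_⟩
    rwa [measureReal_def, measure_congr Iio_ae_eq_Iic]
  obtain ⟨s₁, hs₁⟩ := htop
  have hbdd : BddAbove T := ⟨s₁, fun s hs => by
    by_contra! hlt
    exact absurd (hmono hlt.le) (not_le.2 (lt_of_le_of_lt hs hs₁))⟩
  rcases T.eq_empty_or_nonempty with he | hne
  · have hall : ∀ s, y < μ.real (Iio s) := fun s => by
      by_contra! hle
      have : s ∈ T := hle
      rw [he] at this; exact this
    have h1 : Tendsto (fun s => μ (Iic s)) atBot (𝓝 0) := by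
      have h := tendsto_measure_iInter_atBot (μ := μ) (s := fun s : ℝ => Iic s)
        (fun _ => measurableSet_Iic.nullMeasurableSet) (fun s t h => Iic_subset_Iic.2 h)
        ⟨0, measure_ne_top _ _⟩
      rwa [iInter_Iic_eq_empty_iff.2 (by simp), measure_empty] at h
    have h2 : Tendsto (fun s => μ.real (Iic s)) atBot (𝓝 0) :=
      (ENNReal.tendsto_toReal ENNReal.zero_ne_top).comp h1
    have h3 : y ≤ 0 := ge_of_tendsto' h2 fun s =>
      (hall s).le.trans (measureReal_mono Iio_subset_Iic_self)
    rw [he, measure_empty, ENNReal.ofReal_of_nonpos h3]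
  · have hcl : IsClosed T := isClosed_Iic.preimage hc
    have hmem : sSup T ∈ T := hcl.csSup_mem hne hbdd
    have hTeq : T = Iic (sSup T) := by
      ext s
      constructor
      · intro hs; exact le_csSup hbdd hs
      · intro hs; exact (hmono hs).trans hmem
    have hge : y ≤ μ.real (Iio (sSup T)) := by
      have h1 : Tendsto (fun s => μ.real (Iio s)) (𝓝[>] (sSup T)) (𝓝 (μ.real (Iio (sSup T)))) :=
        hc.continuousAt.tendsto.mono_left nhdsWithin_le_nhds
      refine ge_of_tendsto h1 ?_
      filter_upwards [self_mem_nhdsWithin] with s hs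
      by_contra! hle
      have : s ∈ T := hle.le
      exact absurd (le_csSup hbdd this) (not_le.2 hs)
    have heq : μ.real (Iio (sSup T)) = y := le_antisymm hmem hge
    rw [hTeq, ← measure_congr Iio_ae_eq_Iic, ← heq, ofReal_measureReal]

lemma lintegral_comp_measure_Iio (μ : Measure ℝ) [IsFiniteMeasure μ] [NullSingletonClass μ]
    {h : ℝ≥0∞ → ℝ≥0∞} (hh : Measurable h) :
    ∫⁻ s, h (μ (Iio s)) ∂μ = ∫⁻ y in Ioc 0 (μ.real univ), h (ENNReal.ofReal y) := by
  rw [← map_measureReal_Iio μ, lintegral_map (f := fun y => h (ENNReal.ofReal y)) (by fun_prop)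
    (continuous_measureReal_Iio μ).measurable]
  exact lintegral_congr fun s => by rw [ofReal_measureReal]

lemma lintegral_comp_measure_Ioi (μ : Measure ℝ) [IsFiniteMeasure μ] [NullSingletonClass μ]
    {h : ℝ≥0∞ → ℝ≥0∞} (hh : Measurable h) :
    ∫⁻ s, h (μ (Ioi s)) ∂μ = ∫⁻ y in Ioc 0 (μ.real univ), h (ENNReal.ofReal y) := by
  have hna : NullSingletonClass (μ.map Neg.neg) := ⟨fun x => by
    rw [Measure.map_apply measurable_neg (measurableSet_singleton x)]; simp⟩
  have h1 := lintegral_comp_measure_Iio (μ.map Neg.neg) hh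
  have hm : Measurable fun s => h ((μ.map Neg.neg) (Iio s)) :=
    hh.comp (Monotone.measurable fun s t hst => measure_mono (Iio_subset_Iio hst))
  rw [lintegral_map hm measurable_neg, measureReal_def,
    Measure.map_apply measurable_neg MeasurableSet.univ] at h1
  simp only [Measure.map_apply measurable_neg measurableSet_Iio, neg_preimage, neg_Iio, neg_neg,
    preimage_univ] at h1
  exact h1

lemma noAtoms_withDensity_restrict (σ : ℝ → ℝ≥0∞) (A : Set ℝ) :
    NullSingletonClass ((volume.restrict A).withDensity σ) :=
  ⟨fun _ => withDensity_absolutelyContinuous _ _ (measure_singleton _)⟩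

lemma lintegral_comp_primitive {σ : ℝ → ℝ≥0∞} (hσ : Measurable σ) {c d : ℝ}
    (hfin : ∫⁻ s in Ioo c d, σ s ≠ ∞) {h : ℝ≥0∞ → ℝ≥0∞} (hh : Measurable h) :
    ∫⁻ s in Ioo c d, σ s * h (∫⁻ y in Ioo c s, σ y) =
      ∫⁻ y in Ioc 0 (∫⁻ s in Ioo c d, σ s).toReal, h (ENNReal.ofReal y) := by
  have := noAtoms_withDensity_restrict σ (Ioo c d)
  have : IsFiniteMeasure ((volume.restrict (Ioo c d)).withDensity σ) :=
    isFiniteMeasure_withDensity hfin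
  have h1 := lintegral_comp_measure_Iio ((volume.restrict (Ioo c d)).withDensity σ) hh
  have hm : Measurable fun s => h (((volume.restrict (Ioo c d)).withDensity σ) (Iio s)) :=
    hh.comp (Monotone.measurable fun s t hst => measure_mono (Iio_subset_Iio hst))
  rw [lintegral_withDensity_eq_lintegral_mul _ hσ hm] at h1
  rw [measureReal_def, withDensity_apply _ MeasurableSet.univ, Measure.restrict_univ] at h1
  rw [← h1]
  refine setLIntegral_congr_fun measurableSet_Ioo fun s hs => ?_
  simp only [Pi.mul_apply]
  rw [withDensity_apply _ measurableSet_Iio, Measure.restrict_restrict measurableSet_Iio]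
  have : Iio s ∩ Ioo c d = Ioo c s := by
    ext z; simp only [mem_inter_iff, mem_Iio, mem_Ioo]
    exact ⟨fun h => ⟨h.2.1, h.1⟩, fun h => ⟨h.2, h.1, h.2.trans hs.2⟩⟩
  rw [this]

lemma lintegral_comp_tail {σ : ℝ → ℝ≥0∞} (hσ : Measurable σ) {c d : ℝ}
    (hfin : ∫⁻ s in Ioo c d, σ s ≠ ∞) {h : ℝ≥0∞ → ℝ≥0∞} (hh : Measurable h) :
    ∫⁻ s in Ioo c d, σ s * h (∫⁻ y in Ioo s d, σ y) =
      ∫⁻ y in Ioc 0 (∫⁻ s in Ioo c d, σ s).toReal, h (ENNReal.ofReal y) := by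
  have := noAtoms_withDensity_restrict σ (Ioo c d)
  have : IsFiniteMeasure ((volume.restrict (Ioo c d)).withDensity σ) :=
    isFiniteMeasure_withDensity hfin
  have h1 := lintegral_comp_measure_Ioi ((volume.restrict (Ioo c d)).withDensity σ) hh
  have hm : Measurable fun s => h (((volume.restrict (Ioo c d)).withDensity σ) (Ioi s)) :=
    hh.comp (Antitone.measurable fun s t hst => measure_mono (Ioi_subset_Ioi hst))
  rw [lintegral_withDensity_eq_lintegral_mul _ hσ hm] at h1
  rw [measureReal_def, withDensity_apply _ MeasurableSet.univ, Measure.restrict_univ] at h1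
  rw [← h1]
  refine setLIntegral_congr_fun measurableSet_Ioo fun s hs => ?_
  simp only [Pi.mul_apply]
  rw [withDensity_apply _ measurableSet_Ioi, Measure.restrict_restrict measurableSet_Ioi]
  have : Ioi s ∩ Ioo c d = Ioo s d := by
    ext z; simp only [mem_inter_iff, mem_Ioi, mem_Ioo]
    exact ⟨fun h => ⟨h.1, h.2.2⟩, fun h => ⟨h.1, hs.1.trans h.1, h.2⟩⟩
  rw [this]

lemma setLIntegral_ofReal_rpow {β S : ℝ} (hβ : -1 < β) (hS : 0 ≤ S) :
    ∫⁻ y in Ioc 0 S, ENNReal.ofReal y ^ β =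
      ENNReal.ofReal S ^ (β + 1) * ENNReal.ofReal (β + 1)⁻¹ := by
  have h1 : ∫⁻ y in Ioc 0 S, ENNReal.ofReal y ^ β = ∫⁻ y in Ioc 0 S, ENNReal.ofReal (y ^ β) :=
    setLIntegral_congr_fun measurableSet_Ioc fun y hy => ENNReal.ofReal_rpow_of_pos hy.1
  have hint : IntegrableOn (fun y : ℝ => y ^ β) (Ioc 0 S) := by
    rw [← intervalIntegrable_iff_integrableOn_Ioc_of_le hS]
    exact intervalIntegral.intervalIntegrable_rpow' hβ
  rw [h1, ← ofReal_integral_eq_lintegral_ofReal hint, ← intervalIntegral.integral_of_le hS,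
    integral_rpow (Or.inl hβ), Real.zero_rpow (by linarith), sub_zero, div_eq_mul_inv,
    ENNReal.ofReal_mul (by positivity), ENNReal.ofReal_rpow_of_nonneg hS (by linarith)]
  refine (ae_restrict_mem measurableSet_Ioc).mono fun y hy => ?_
  exact Real.rpow_nonneg hy.1.le _

lemma lintegral_primitive_rpow {σ : ℝ → ℝ≥0∞} (hσ : Measurable σ) {c d : ℝ}
    (hfin : ∫⁻ s in Ioo c d, σ s ≠ ∞) {β : ℝ} (hβ : -1 < β) :
    ∫⁻ s in Ioo c d, σ s * (∫⁻ y in Ioo c s, σ y) ^ β =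
      (∫⁻ s in Ioo c d, σ s) ^ (β + 1) * ENNReal.ofReal (β + 1)⁻¹ := by
  rw [lintegral_comp_primitive hσ hfin (h := fun z => z ^ β) (by fun_prop),
    setLIntegral_ofReal_rpow hβ ENNReal.toReal_nonneg, ENNReal.ofReal_toReal hfin]

lemma lintegral_tail_rpow {σ : ℝ → ℝ≥0∞} (hσ : Measurable σ) {c d : ℝ}
    (hfin : ∫⁻ s in Ioo c d, σ s ≠ ∞) {β : ℝ} (hβ : -1 < β) :
    ∫⁻ s in Ioo c d, σ s * (∫⁻ y in Ioo s d, σ y) ^ β =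
      (∫⁻ s in Ioo c d, σ s) ^ (β + 1) * ENNReal.ofReal (β + 1)⁻¹ := by
  rw [lintegral_comp_tail hσ hfin (h := fun z => z ^ β) (by fun_prop),
    setLIntegral_ofReal_rpow hβ ENNReal.toReal_nonneg, ENNReal.ofReal_toReal hfin]

lemma measurable_primitive (h : ℝ → ℝ≥0∞) (c : ℝ) : Measurable fun t => ∫⁻ s in Ioo c t, h s :=
  Monotone.measurable fun _ _ hst => lintegral_mono_set (Ioo_subset_Ioo_right hst)

lemma measurable_tail (h : ℝ → ℝ≥0∞) (d : ℝ) : Measurable fun t => ∫⁻ s in Ioo t d, h s :=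
  Antitone.measurable fun _ _ hst => lintegral_mono_set (Ioo_subset_Ioo_left hst)

lemma lintegral_mul_tail_eq {h k : ℝ → ℝ≥0∞} (hh : Measurable h) (hk : Measurable k) (c d : ℝ) :
    ∫⁻ s in Ioo c d, h s * ∫⁻ t in Ioo s d, k t =
      ∫⁻ t in Ioo c d, k t * ∫⁻ s in Ioo c t, h s := by
  have key : ∀ s ∈ Ioo c d, h s * ∫⁻ t in Ioo s d, k t =
      ∫⁻ t in Ioo c d, {p : ℝ × ℝ | p.1 < p.2}.indicator (fun p => h p.1 * k p.2) (s, t) := by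
    intro s hs
    rw [← lintegral_const_mul _ hk, ← lintegral_indicator measurableSet_Ioo,
      ← lintegral_indicator measurableSet_Ioo]
    refine lintegral_congr fun t => ?_
    by_cases h1 : s < t <;> by_cases h2 : t < d
    · simp [indicator, h1, h2, hs.1.trans h1]
    · simp [indicator, h2]
    · simp [indicator, h1]
    · simp [indicator, h1]
  have key2 : ∀ t ∈ Ioo c d, k t * ∫⁻ s in Ioo c t, h s =
      ∫⁻ s in Ioo c d, {p : ℝ × ℝ | p.1 < p.2}.indicator (fun p => h p.1 * k p.2) (s, t) := by
    intro t ht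
    rw [← lintegral_const_mul _ hh, ← lintegral_indicator measurableSet_Ioo,
      ← lintegral_indicator measurableSet_Ioo]
    refine lintegral_congr fun s => ?_
    by_cases h1 : s < t <;> by_cases h2 : c < s
    · simp [indicator, h1, h2, h1.trans ht.2, mul_comm]
    · simp [indicator, h2]
    · simp [indicator, h1]
    · simp [indicator, h1]
  rw [setLIntegral_congr_fun measurableSet_Ioo key, setLIntegral_congr_fun measurableSet_Ioo key2]
  refine lintegral_lintegral_swap (Measurable.aemeasurable ?_)
  refine Measurable.indicator (by fun_prop) (measurableSet_lt measurable_fst measurable_snd)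

/-- An integral over an open interval is exhausted by moving the left endpoint. -/
lemma setLIntegral_Ioo_le_of_forall_left {h : ℝ → ℝ≥0∞} {a d : ℝ} {K : ℝ≥0∞}
    (hK : ∀ c ∈ Ioo a d, ∫⁻ s in Ioo c d, h s ≤ K) : ∫⁻ s in Ioo a d, h s ≤ K := by
  rcases le_or_gt d a with hda | had
  · simp [Ioo_eq_empty (not_lt.2 hda)]
  obtain ⟨x, hx, hxm, hlim⟩ := exists_seq_strictAnti_tendsto' had
  have hU : Ioo a d = ⋃ n, Ioo (x n) d := by
    ext z
    simp only [mem_iUnion, mem_Ioo]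
    constructor
    · intro hz
      obtain ⟨n, hn⟩ := (hlim.eventually (gt_mem_nhds hz.1)).exists
      exact ⟨n, hn, hz.2⟩
    · rintro ⟨n, hn⟩
      exact ⟨(hxm n).1.trans hn.1, hn.2⟩
  rw [hU, setLIntegral_iUnion_of_directed]
  · exact iSup_le fun n => hK _ (hxm n)

  · exact (monotone_nat_of_le_succ fun n =>
      Ioo_subset_Ioo_left (hx (Nat.lt_succ_self n)).le).directed_le

lemma setLIntegral_Ioi_ofReal_rpow {α s : ℝ} (hα : 0 < α) (hs : 0 < s) :
    ∫⁻ y in Ioi s, ENNReal.ofReal y ^ (-1 - α) =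
      ENNReal.ofReal s ^ (-α) * ENNReal.ofReal α⁻¹ := by
  have h1 : ∫⁻ y in Ioi s, ENNReal.ofReal y ^ (-1 - α) =
      ∫⁻ y in Ioi s, ENNReal.ofReal (y ^ (-1 - α)) :=
    setLIntegral_congr_fun measurableSet_Ioi fun y hy =>
      ENNReal.ofReal_rpow_of_pos (hs.trans hy)
  rw [h1, ← ofReal_integral_eq_lintegral_ofReal
    (integrableOn_Ioi_rpow_of_lt (by linarith) hs), integral_Ioi_rpow_of_lt (by linarith) hs]
  · rw [ENNReal.ofReal_rpow_of_pos hs, ← ENNReal.ofReal_mul (by positivity)]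
    congr 1
    rw [show -1 - α + 1 = -α by ring]
    field_simp
  · refine (ae_restrict_mem measurableSet_Ioi).mono fun y hy => ?_
    exact Real.rpow_nonneg (hs.trans hy).le _

lemma setLIntegral_Ioc_indicator_rpow_le {α S : ℝ} (hα : 0 < α) {z : ℝ≥0∞} (hz0 : z ≠ 0)
    (hz : z ≠ ∞) :
    ∫⁻ y in Ioc 0 S, (Ici z).indicator (fun x => x ^ (-1 - α)) (ENNReal.ofReal y) ≤
      z ^ (-α) * ENNReal.ofReal α⁻¹ := by
  have hzr : 0 < z.toReal := ENNReal.toReal_pos hz0 hz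
  conv_rhs => rw [← ENNReal.ofReal_toReal hz, ← setLIntegral_Ioi_ofReal_rpow hα hzr]
  rw [← setLIntegral_congr Ioi_ae_eq_Ici.symm, ← lintegral_indicator measurableSet_Ioc,
    ← lintegral_indicator measurableSet_Ici]
  refine lintegral_mono fun y => ?_
  by_cases hy : y ∈ Ioc 0 S
  · rw [indicator_of_mem hy]
    by_cases hy2 : z ≤ ENNReal.ofReal y
    · rw [indicator_of_mem (show _ ∈ Ici z from hy2), indicator_of_mem]
      exact (ENNReal.le_ofReal_iff_toReal_le hz hy.1.le).1 hy2
    · rw [indicator_of_notMem (show _ ∉ Ici z from hy2)]; exact zero_le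
  · rw [indicator_of_notMem hy]; exact zero_le

lemma lintegral_primitive_rpow_neg_le {σ : ℝ → ℝ≥0∞} (hσ : Measurable σ) {c s d : ℝ}
    (hcs : c ≤ s) (hfin : ∫⁻ s in Ioo c d, σ s ≠ ∞) {α : ℝ} (hα : 0 < α) :
    ∫⁻ t in Ioo s d, σ t * (∫⁻ y in Ioo c t, σ y) ^ (-1 - α) ≤
      (∫⁻ y in Ioo c s, σ y) ^ (-α) * ENNReal.ofReal α⁻¹ := by
  rcases le_or_gt d s with hds | hsd
  · simp [Ioo_eq_empty (not_lt.2 hds)]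
  set z := ∫⁻ y in Ioo c s, σ y with hz
  have hzt : z ≠ ∞ := ne_top_of_le_ne_top hfin (lintegral_mono_set (Ioo_subset_Ioo_right hsd.le))
  rcases eq_or_ne z 0 with hz0 | hz0
  · rw [hz0, ENNReal.zero_rpow_of_neg (by linarith), ENNReal.top_mul (by simpa using hα)]
    exact le_top
  refine le_trans ?_ (setLIntegral_Ioc_indicator_rpow_le (S := (∫⁻ s in Ioo c d, σ s).toReal)
    hα hz0 hzt)
  rw [← lintegral_comp_primitive hσ hfin
    (Measurable.indicator (by fun_prop) measurableSet_Ici)]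
  refine (setLIntegral_mono' measurableSet_Ioo fun t ht => ?_).trans
    (lintegral_mono_set (Ioo_subset_Ioo_left hcs))
  rw [indicator_of_mem]
  exact lintegral_mono_set (Ioo_subset_Ioo_right ht.1.le)

lemma lintegral_tail_rpow_neg_le {σ : ℝ → ℝ≥0∞} (hσ : Measurable σ) {a s d : ℝ}
    (hsd : s ≤ d) (hfin : ∀ x ∈ Ioo a d, ∫⁻ s in Ioo x d, σ s ≠ ∞) {α : ℝ} (hα : 0 < α) :
    ∫⁻ t in Ioo a s, σ t * (∫⁻ y in Ioo t d, σ y) ^ (-1 - α) ≤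
      (∫⁻ y in Ioo s d, σ y) ^ (-α) * ENNReal.ofReal α⁻¹ := by
  rcases le_or_gt s a with hds | has
  · simp [Ioo_eq_empty (not_lt.2 hds)]
  set z := ∫⁻ y in Ioo s d, σ y with hz
  have hzt : z ≠ ∞ := by
    rcases hsd.eq_or_lt with h | h
    · rw [hz, h]; simp
    · exact hfin s ⟨has, h⟩
  rcases eq_or_ne z 0 with hz0 | hz0
  · rw [hz0, ENNReal.zero_rpow_of_neg (by linarith), ENNReal.top_mul (by simpa using hα)]
    exact le_top
  refine setLIntegral_Ioo_le_of_forall_left fun c hc => ?_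
  have hfin' := hfin c ⟨hc.1, hc.2.trans_le hsd⟩
  refine le_trans ?_ (setLIntegral_Ioc_indicator_rpow_le (S := (∫⁻ s in Ioo c d, σ s).toReal)
    hα hz0 hzt)
  rw [← lintegral_comp_tail hσ hfin'
    (Measurable.indicator (by fun_prop) measurableSet_Ici)]
  refine (setLIntegral_mono' measurableSet_Ioo fun t ht => ?_).trans
    (lintegral_mono_set (Ioo_subset_Ioo_right hsd))
  rw [indicator_of_mem]
  exact lintegral_mono_set (Ioo_subset_Ioo_left ht.2.le)

lemma tail_rpow_neg_le {σ : ℝ → ℝ≥0∞} (hσ : Measurable σ) {c s d : ℝ}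
    (hcs : c ≤ s) (hfin : ∫⁻ s in Ioo c d, σ s ≠ ∞)
    (hpos : ∫⁻ y in Ioo s d, σ y ≠ 0) {α : ℝ} (hα : 0 < α) :
    (∫⁻ y in Ioo s d, σ y) ^ (-α) ≤ (∫⁻ y in Ioo c d, σ y) ^ (-α) +
      ENNReal.ofReal α * ∫⁻ t in Ioo c s, σ t * (∫⁻ y in Ioo t d, σ y) ^ (-1 - α) := by
  set z := ∫⁻ y in Ioo s d, σ y with hz
  set Z := ∫⁻ y in Ioo c d, σ y with hZ
  have hzZ : z ≤ Z := lintegral_mono_set (Ioo_subset_Ioo_left hcs)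
  have hzt : z ≠ ∞ := ne_top_of_le_ne_top hfin hzZ
  have hzr : 0 < z.toReal := ENNReal.toReal_pos hpos hzt
  have hzZr : z.toReal ≤ Z.toReal := ENNReal.toReal_mono hfin hzZ
  have hα1 : ENNReal.ofReal α * ENNReal.ofReal α⁻¹ = 1 := by
    rw [← ENNReal.ofReal_mul hα.le, mul_inv_cancel₀ hα.ne', ENNReal.ofReal_one]
  have e1 := setLIntegral_Ioi_ofReal_rpow hα hzr
  have e2 := setLIntegral_Ioi_ofReal_rpow hα (hzr.trans_le hzZr)
  rw [ENNReal.ofReal_toReal hzt] at e1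
  rw [ENNReal.ofReal_toReal hfin] at e2
  have e3 : ∫⁻ y in Ioi z.toReal, ENNReal.ofReal y ^ (-1 - α) =
      (∫⁻ y in Ioc z.toReal Z.toReal, ENNReal.ofReal y ^ (-1 - α)) +
        ∫⁻ y in Ioi Z.toReal, ENNReal.ofReal y ^ (-1 - α) := by
    rw [← Ioc_union_Ioi_eq_Ioi hzZr, lintegral_union measurableSet_Ioi]
    exact (Ioc_disjoint_Ioi le_rfl)
  have e4 : ∫⁻ y in Ioc z.toReal Z.toReal, ENNReal.ofReal y ^ (-1 - α) ≤
      ∫⁻ t in Ioo c s, σ t * (∫⁻ y in Ioo t d, σ y) ^ (-1 - α) := by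
    have e5 := lintegral_comp_tail hσ hfin (h := (Ioi z).indicator fun x => x ^ (-1 - α))
      (Measurable.indicator (by fun_prop) measurableSet_Ioi)
    have e6 : ∫⁻ y in Ioc z.toReal Z.toReal, ENNReal.ofReal y ^ (-1 - α) ≤
        ∫⁻ y in Ioc 0 Z.toReal, (Ioi z).indicator (fun x => x ^ (-1 - α)) (ENNReal.ofReal y) := by
      refine (setLIntegral_mono' measurableSet_Ioc fun y hy => ?_).trans
        (lintegral_mono_set (Ioc_subset_Ioc_left hzr.le))
      rw [indicator_of_mem]
      exact (ENNReal.lt_ofReal_iff_toReal_lt hzt).2 hy.1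
    refine e6.trans (e5.symm.le.trans ?_)
    rw [← lintegral_indicator measurableSet_Ioo, ← lintegral_indicator measurableSet_Ioo]
    refine lintegral_mono fun t => ?_
    by_cases ht : t ∈ Ioo c d
    · rw [indicator_of_mem ht]
      by_cases hts : t < s
      · rw [indicator_of_mem (show t ∈ Ioo c s from ⟨ht.1, hts⟩)]
        gcongr
        exact indicator_le_self _ _ _
      · rw [indicator_of_notMem (show ∫⁻ y in Ioo t d, σ y ∉ Ioi z from not_lt.2
          (lintegral_mono_set (Ioo_subset_Ioo_left (not_lt.1 hts)))), mul_zero]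
        exact zero_le
    · rw [indicator_of_notMem ht]; exact zero_le
  calc z ^ (-α) = ENNReal.ofReal α * (z ^ (-α) * ENNReal.ofReal α⁻¹) := by
        rw [mul_left_comm, hα1, mul_one]
    _ = ENNReal.ofReal α * ((∫⁻ y in Ioc z.toReal Z.toReal, ENNReal.ofReal y ^ (-1 - α)) +
        Z ^ (-α) * ENNReal.ofReal α⁻¹) := by rw [← e1, e3, e2]
    _ = Z ^ (-α) + ENNReal.ofReal α *
        ∫⁻ y in Ioc z.toReal Z.toReal, ENNReal.ofReal y ^ (-1 - α) := by
        rw [mul_add, mul_left_comm _ (Z ^ (-α)), hα1, mul_one, add_comm]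
    _ ≤ _ := by gcongr

lemma rpow_mul_rpow_of_add {z : ℝ≥0∞} (h0 : z ≠ 0) (ht : z ≠ ∞) {a b c : ℝ} (h : a + b = c) :
    z ^ a * z ^ b = z ^ c := by
  rw [← ENNReal.rpow_add _ _ h0 ht, h]

lemma rpow_rpow_of_mul (z : ℝ≥0∞) {a b c : ℝ} (h : a * b = c) : (z ^ a) ^ b = z ^ c := by
  rw [← ENNReal.rpow_mul, h]

lemma hardy_exists (r : ℝ) (hr0 : 0 < r) (hr1 : r < 1) :
    ∃ K : ℝ≥0∞, K ≠ ∞ ∧ ∀ (x d : ℝ) (v f : ℝ → ℝ≥0∞), Measurable v → Measurable f →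
      (∫⁻ s in Ioo x d, v s ^ (1 / (1 - r)) ≠ ∞) →
      (∀ t ∈ Ioo x d, ∫⁻ s in Ioo x t, v s ^ (1 / (1 - r)) ≠ 0) →
      ∫⁻ t in Ioo x d, v t ^ (1 / (1 - r)) *
        ((∫⁻ s in Ioo x t, f s ^ r * v s) * (∫⁻ s in Ioo x t, v s ^ (1 / (1 - r)))⁻¹) ^ (1 / r) ≤
      K * ∫⁻ t in Ioo x d, f t := by
  have hr1' : 0 < 1 - r := by linarith
  set α : ℝ := (1 - r) / (2 * r) with hα
  have hαpos : 0 < α := by positivity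
  set c₁ : ℝ≥0∞ := ENNReal.ofReal (-(1 / 2 : ℝ) + 1)⁻¹ with hc₁
  refine ⟨c₁ ^ ((1 - r) / r) * ENNReal.ofReal α⁻¹, ENNReal.mul_ne_top
    (ENNReal.rpow_ne_top_of_nonneg (by positivity) ENNReal.ofReal_ne_top) ENNReal.ofReal_ne_top,
    fun x d v f hv hf hfin hpos => ?_⟩
  set σ : ℝ → ℝ≥0∞ := fun s => v s ^ (1 / (1 - r)) with hσ
  have hσm : Measurable σ := by fun_prop
  set S : ℝ → ℝ≥0∞ := fun t => ∫⁻ s in Ioo x t, σ s with hS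
  have hSm : Measurable S := measurable_primitive σ x
  have hStop : ∀ t ∈ Ioo x d, S t ≠ ∞ := fun t ht =>
    ne_top_of_le_ne_top hfin (lintegral_mono_set (Ioo_subset_Ioo_right ht.2.le))
  have hσv : ∀ s, σ s ^ (1 - r) = v s := fun s => by
    rw [hσ]; simp only
    rw [rpow_rpow_of_mul _ (c := 1) (by field_simp), ENNReal.rpow_one]
  have hpt : ∀ t ∈ Ioo x d, σ t * ((∫⁻ s in Ioo x t, f s ^ r * v s) * (S t)⁻¹) ^ (1 / r) ≤
      c₁ ^ ((1 - r) / r) * ((σ t * S t ^ (-1 - α)) * ∫⁻ s in Ioo x t, f s * S s ^ α) := by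
    intro t ht
    have h1 : ∫⁻ s in Ioo x t, f s ^ r * v s ≤
        (∫⁻ s in Ioo x t, f s * S s ^ α) ^ r *
          (∫⁻ s in Ioo x t, σ s * S s ^ (-(1 / 2 : ℝ))) ^ (1 - r) := by
      refine le_trans (le_of_eq ?_) (ENNReal.lintegral_mul_norm_pow_le (by fun_prop) (by fun_prop)
        hr0.le hr1'.le (by ring))
      refine setLIntegral_congr_fun measurableSet_Ioo fun s hs => ?_
      have hs' : s ∈ Ioo x d := ⟨hs.1, hs.2.trans ht.2⟩
      rw [ENNReal.mul_rpow_of_nonneg _ _ hr0.le, ENNReal.mul_rpow_of_nonneg _ _ hr1'.le, hσv,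
        rpow_rpow_of_mul _ (c := (1 - r) / 2) (by rw [hα]; field_simp),
        rpow_rpow_of_mul _ (c := -((1 - r) / 2)) (by ring), mul_mul_mul_comm, ← mul_assoc]
      rw [mul_assoc (f s ^ r * v s), rpow_mul_rpow_of_add (hpos s hs') (hStop s hs')
        (add_neg_cancel _), ENNReal.rpow_zero, mul_one]
    rw [lintegral_primitive_rpow hσm (hStop t ht) (by norm_num)] at h1
    calc σ t * ((∫⁻ s in Ioo x t, f s ^ r * v s) * (S t)⁻¹) ^ (1 / r)
        ≤ σ t * (((∫⁻ s in Ioo x t, f s * S s ^ α) ^ r *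
          (S t ^ (-(1 / 2 : ℝ) + 1) * c₁) ^ (1 - r)) * (S t)⁻¹) ^ (1 / r) := by gcongr
      _ = _ := by
        rw [ENNReal.mul_rpow_of_nonneg _ _ (by positivity),
          ENNReal.mul_rpow_of_nonneg _ _ (by positivity),
          rpow_rpow_of_mul _ (c := 1) (by field_simp),
          rpow_rpow_of_mul _ (c := (1 - r) / r) (by field_simp),
          ENNReal.mul_rpow_of_nonneg _ _ (by positivity), ENNReal.rpow_one, ← ENNReal.rpow_neg_one,
          rpow_rpow_of_mul _ (c := (1 - r) / (2 * r)) (by field_simp; ring),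
          rpow_rpow_of_mul _ (c := -1 / r) (by field_simp),
          ← rpow_mul_rpow_of_add (hpos t ht) (hStop t ht)
            (show (1 - r) / (2 * r) + -1 / r = -1 - α by rw [hα]; field_simp; ring)]
        ring
  calc _ ≤ ∫⁻ t in Ioo x d, c₁ ^ ((1 - r) / r) *
        ((σ t * S t ^ (-1 - α)) * ∫⁻ s in Ioo x t, f s * S s ^ α) :=
        setLIntegral_mono' measurableSet_Ioo hpt
    _ = c₁ ^ ((1 - r) / r) * ∫⁻ t in Ioo x d,
        (f t * S t ^ α) * ∫⁻ s in Ioo t d, σ s * S s ^ (-1 - α) := by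
        have mG : Measurable fun t => ∫⁻ s in Ioo x t, f s * S s ^ α := measurable_primitive _ _
        rw [lintegral_const_mul _ (by fun_prop),
          lintegral_mul_tail_eq (by fun_prop) (by fun_prop)]
    _ ≤ c₁ ^ ((1 - r) / r) * ∫⁻ t in Ioo x d, ENNReal.ofReal α⁻¹ * f t := by
        refine mul_le_mul_right (setLIntegral_mono' measurableSet_Ioo fun t ht => ?_) _
        calc _ ≤ (f t * S t ^ α) * (S t ^ (-α) * ENNReal.ofReal α⁻¹) := by
              gcongr
              exact lintegral_primitive_rpow_neg_le hσm ht.1.le hfin hαpos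
          _ = f t * (S t ^ α * S t ^ (-α)) * ENNReal.ofReal α⁻¹ := by ring
          _ = _ := by
              rw [rpow_mul_rpow_of_add (hpos t ht) (hStop t ht) (add_neg_cancel _),
                ENNReal.rpow_zero, mul_one, mul_comm]
    _ = _ := by rw [lintegral_const_mul _ hf, mul_assoc]

lemma lintegral_primitive_rpow_mul_tail_rpow {σ u : ℝ → ℝ≥0∞} (hσ : Measurable σ)
    (hu : Measurable u) {x d : ℝ} (hσfin : ∫⁻ s in Ioo x d, σ s ≠ ∞)
    (hufin : ∫⁻ s in Ioo x d, u s ≠ ∞) {β γ : ℝ} (hβ : -1 < β) (hγ : -1 < γ) :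
    (∫⁻ t in Ioo x d, (σ t * (∫⁻ s in Ioo x t, σ s) ^ β) * (∫⁻ s in Ioo t d, u s) ^ (γ + 1)) *
        ENNReal.ofReal (γ + 1)⁻¹ =
      (∫⁻ t in Ioo x d, (u t * (∫⁻ s in Ioo t d, u s) ^ γ) * (∫⁻ s in Ioo x t, σ s) ^ (β + 1)) *
        ENNReal.ofReal (β + 1)⁻¹ := by
  have m1 := measurable_primitive σ x
  have m2 := measurable_tail u d
  have h := lintegral_mul_tail_eq (h := fun t => σ t * (∫⁻ s in Ioo x t, σ s) ^ β)
    (k := fun t => u t * (∫⁻ s in Ioo t d, u s) ^ γ)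
    (hσ.mul (m1.pow_const _)) (hu.mul (m2.pow_const _)) x d
  rw [← lintegral_mul_const _ (by fun_prop), ← lintegral_mul_const _ (by fun_prop)]
  convert h using 1
  · refine setLIntegral_congr_fun measurableSet_Ioo fun t ht => ?_
    rw [lintegral_tail_rpow hu (ne_top_of_le_ne_top hufin (lintegral_mono_set
      (Ioo_subset_Ioo_left ht.1.le))) hγ, mul_assoc]
  · refine setLIntegral_congr_fun measurableSet_Ioo fun t ht => ?_
    rw [lintegral_primitive_rpow hσ (ne_top_of_le_ne_top hσfin (lintegral_mono_set
      (Ioo_subset_Ioo_right ht.2.le))) hβ, mul_assoc]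

lemma ofReal_inv_mul_cancel {x : ℝ} (hx : 0 < x) : ENNReal.ofReal x⁻¹ * ENNReal.ofReal x = 1 := by
  rw [← ENNReal.ofReal_mul (by positivity), inv_mul_cancel₀ hx.ne', ENNReal.ofReal_one]

/-- Weighted Hardy inequality `L^{1/r} → L^{q/r}` with `q < 1`, written for `f ^ r * v`. -/
lemma mazya_exists (r q : ℝ) (hr0 : 0 < r) (hrq : r < q) (hq1 : q < 1) :
    ∃ K : ℝ≥0∞, K ≠ ∞ ∧ ∀ (x d : ℝ) (u v f : ℝ → ℝ≥0∞), Measurable u → Measurable v →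
      Measurable f → (∫⁻ s in Ioo x d, v s ^ (1 / (1 - r)) ≠ ∞) →
      (∫⁻ s in Ioo x d, u s ≠ ∞) → (∫⁻ s in Ioo x d, f s ^ r * v s ≠ ∞) →
      (∀ t ∈ Ioo x d, ∫⁻ s in Ioo x t, v s ^ (1 / (1 - r)) ≠ 0) →
      ∫⁻ t in Ioo x d, u t * (∫⁻ s in Ioo x t, f s ^ r * v s) ^ (q / r) ≤
      K * ((∫⁻ t in Ioo x d, (u t * (∫⁻ s in Ioo t d, u s) ^ (q / (1 - q))) *
        (∫⁻ s in Ioo x t, v s ^ (1 / (1 - r))) ^ (q * (1 - r) / (r * (1 - q)))) ^ (1 - q) *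
        (∫⁻ t in Ioo x d, f t) ^ q) := by
  have hr1' : 0 < 1 - r := by linarith
  have hq1' : 0 < 1 - q := by linarith
  have hqr : 0 < q - r := by linarith
  have hq0 : 0 < q := by linarith
  obtain ⟨K₁, hK₁, hardy⟩ := hardy_exists r hr0 (by linarith)
  set γ : ℝ := q / (1 - q) with hγ
  have hγpos : 0 < γ := by positivity
  have hγ1 : γ + 1 = 1 / (1 - q) := by rw [hγ]; field_simp; ring
  set β : ℝ := (q - r) / (r * (1 - q)) with hβ
  have hβpos : 0 < β := by positivity
  have hβ1 : β + 1 = q * (1 - r) / (r * (1 - q)) := by rw [hβ]; field_simp; ring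
  set c₁ := ENNReal.ofReal (β + 1)⁻¹ * ENNReal.ofReal (γ + 1) with hc₁
  refine ⟨ENNReal.ofReal (q / r) * (c₁ ^ (1 - q) * K₁ ^ (q - r)), by finiteness,
    fun x d u v f hu hv hf hσfin hufin hgfin hpos => ?_⟩
  set σ : ℝ → ℝ≥0∞ := fun s => v s ^ (1 / (1 - r)) with hσ
  have hσm : Measurable σ := by fun_prop
  set S : ℝ → ℝ≥0∞ := fun t => ∫⁻ s in Ioo x t, σ s with hS
  have hSm : Measurable S := measurable_primitive σ x
  set U : ℝ → ℝ≥0∞ := fun t => ∫⁻ s in Ioo t d, u s with hU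
  have hUm : Measurable U := measurable_tail u d
  set g : ℝ → ℝ≥0∞ := fun s => f s ^ r * v s with hg
  have hgm : Measurable g := by fun_prop
  set H : ℝ → ℝ≥0∞ := fun t => ∫⁻ s in Ioo x t, g s with hH
  have hHm : Measurable H := measurable_primitive g x
  have hStop : ∀ t ∈ Ioo x d, S t ≠ ∞ := fun t ht =>
    ne_top_of_le_ne_top hσfin (lintegral_mono_set (Ioo_subset_Ioo_right ht.2.le))
  have hσv : ∀ s, σ s ^ (1 - r) = v s := fun s => by
    rw [hσ]; simp only
    rw [rpow_rpow_of_mul _ (c := 1) (by field_simp), ENNReal.rpow_one]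
  have hA : ∫⁻ t in Ioo x d, (σ t * S t ^ β) * U t ^ (γ + 1) =
      c₁ * ∫⁻ t in Ioo x d, (u t * U t ^ γ) * S t ^ (β + 1) := by
    have h := lintegral_primitive_rpow_mul_tail_rpow hσm hu hσfin hufin
      (β := β) (γ := γ) (by linarith) (by linarith)
    calc _ = (∫⁻ t in Ioo x d, (σ t * S t ^ β) * U t ^ (γ + 1)) *
          (ENNReal.ofReal (γ + 1)⁻¹ * ENNReal.ofReal (γ + 1)) := by
          rw [ofReal_inv_mul_cancel (by linarith), mul_one]
      _ = _ := by rw [← mul_assoc, h, hc₁]; ring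
  have hstep1 : ∫⁻ t in Ioo x d, u t * H t ^ (q / r) =
      ENNReal.ofReal (q / r) * ∫⁻ s in Ioo x d, (g s * H s ^ (q / r - 1)) * U s := by
    have mG : Measurable fun t => ∫⁻ s in Ioo x t, g s * H s ^ (q / r - 1) :=
      measurable_primitive _ _
    rw [lintegral_mul_tail_eq (h := fun s => g s * H s ^ (q / r - 1)) (by fun_prop) hu,
      ← lintegral_const_mul _ (by fun_prop)]
    refine setLIntegral_congr_fun measurableSet_Ioo fun t ht => ?_
    rw [lintegral_primitive_rpow hgm (ne_top_of_le_ne_top hgfin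
      (lintegral_mono_set (Ioo_subset_Ioo_right ht.2.le)))
      (by have : 0 < q / r := by positivity
          linarith), sub_add_cancel]
    calc _ = u t * H t ^ (q / r) * (ENNReal.ofReal (q / r)⁻¹ * ENNReal.ofReal (q / r)) := by
          rw [ofReal_inv_mul_cancel (by positivity), mul_one]
      _ = _ := by ring
  have hQ1 : 0 < q / r - 1 := by rw [sub_pos, lt_div_iff₀ hr0]; linarith
  have hstep2 : ∫⁻ s in Ioo x d, (g s * H s ^ (q / r - 1)) * U s ≤
      (∫⁻ s in Ioo x d, f s) ^ r *
        (∫⁻ s in Ioo x d, σ s * (H s ^ (q / r - 1) * U s) ^ (1 / (1 - r))) ^ (1 - r) := by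
    refine le_trans (le_of_eq ?_) (ENNReal.lintegral_mul_norm_pow_le (by fun_prop) (by fun_prop)
      hr0.le hr1'.le (by ring))
    refine lintegral_congr fun s => ?_
    rw [ENNReal.mul_rpow_of_nonneg _ _ hr1'.le, hσv,
      rpow_rpow_of_mul _ (c := 1) (by field_simp), ENNReal.rpow_one]
    simp only [hg]; ring
  have hstep3 : ∫⁻ s in Ioo x d, σ s * (H s ^ (q / r - 1) * U s) ^ (1 / (1 - r)) ≤
      (∫⁻ t in Ioo x d, (σ t * S t ^ β) * U t ^ (γ + 1)) ^ ((1 - q) / (1 - r)) *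
      (∫⁻ t in Ioo x d, σ t * (H t * (S t)⁻¹) ^ (1 / r)) ^ ((q - r) / (1 - r)) := by
    refine le_trans (le_of_eq ?_) (ENNReal.lintegral_mul_norm_pow_le (by fun_prop) (by fun_prop)
      (by positivity) (by positivity) (by field_simp; ring))
    refine setLIntegral_congr_fun measurableSet_Ioo fun s hs => ?_
    have e1 : (1 - q) / (1 - r) + (q - r) / (1 - r) = 1 := by field_simp; ring
    have p1 : 0 ≤ (1 - q) / (1 - r) := by positivity
    have p2 : 0 ≤ (q - r) / (1 - r) := by positivity
    have hσ1 : σ s ^ ((1 - q) / (1 - r)) * σ s ^ ((q - r) / (1 - r)) = σ s := by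
      rw [← ENNReal.rpow_add_of_nonneg _ _ p1 p2, e1, ENNReal.rpow_one]
    have hS1 : (S s ^ β) ^ ((1 - q) / (1 - r)) *
        (((S s)⁻¹) ^ (1 / r)) ^ ((q - r) / (1 - r)) = 1 := by
      rw [← ENNReal.rpow_neg_one, ← ENNReal.rpow_mul, ← ENNReal.rpow_mul, ← ENNReal.rpow_mul,
        rpow_mul_rpow_of_add (hpos s hs) (hStop s hs) (c := 0), ENNReal.rpow_zero]
      rw [hβ]; field_simp; ring
    rw [ENNReal.mul_rpow_of_nonneg _ _ p1, ENNReal.mul_rpow_of_nonneg _ _ p1,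
      ENNReal.mul_rpow_of_nonneg _ _ p2, ENNReal.mul_rpow_of_nonneg _ _ (by positivity : 0 ≤ 1 / r),
      ENNReal.mul_rpow_of_nonneg _ _ p2,
      ENNReal.mul_rpow_of_nonneg _ _ (by positivity : 0 ≤ 1 / (1 - r))]
    rw [rpow_rpow_of_mul (U s) (c := 1 / (1 - r)) (by rw [hγ1]; field_simp),
      rpow_rpow_of_mul (H s) (c := (q - r) / (r * (1 - r))) (by field_simp),
      rpow_rpow_of_mul (H s) (a := 1 / r) (c := (q - r) / (r * (1 - r))) (by field_simp)]
    calc _ = σ s * (H s ^ ((q - r) / (r * (1 - r))) * U s ^ (1 / (1 - r))) * 1 := by ring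
      _ = (σ s ^ ((1 - q) / (1 - r)) * σ s ^ ((q - r) / (1 - r))) *
        (H s ^ ((q - r) / (r * (1 - r))) * U s ^ (1 / (1 - r))) *
        ((S s ^ β) ^ ((1 - q) / (1 - r)) * (((S s)⁻¹) ^ (1 / r)) ^ ((q - r) / (1 - r))) := by
          rw [hσ1, hS1]
      _ = _ := by ring
  rw [hstep1, ← hβ1]
  calc _ ≤ ENNReal.ofReal (q / r) * ((∫⁻ s in Ioo x d, f s) ^ r *
        ((c₁ * ∫⁻ t in Ioo x d, (u t * U t ^ γ) * S t ^ (β + 1)) ^ ((1 - q) / (1 - r)) *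
        (K₁ * ∫⁻ t in Ioo x d, f t) ^ ((q - r) / (1 - r))) ^ (1 - r)) := by
        refine mul_le_mul_right (hstep2.trans ?_) _
        refine mul_le_mul_right (ENNReal.rpow_le_rpow (hstep3.trans ?_) hr1'.le) _
        rw [hA]
        refine mul_le_mul_right (ENNReal.rpow_le_rpow ?_ (by positivity)) _
        exact hardy x d v f hv hf hσfin hpos
    _ = ENNReal.ofReal (q / r) * ((∫⁻ s in Ioo x d, f s) ^ r *
        ((c₁ * ∫⁻ t in Ioo x d, (u t * U t ^ γ) * S t ^ (β + 1)) ^ (1 - q) *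
        (K₁ * ∫⁻ t in Ioo x d, f t) ^ (q - r))) := by
        rw [ENNReal.mul_rpow_of_nonneg _ _ hr1'.le, rpow_rpow_of_mul _ (c := 1 - q) (by field_simp),
          rpow_rpow_of_mul _ (c := q - r) (by field_simp)]
    _ = _ := by
        rw [ENNReal.mul_rpow_of_nonneg _ _ hq1'.le, ENNReal.mul_rpow_of_nonneg _ _ hqr.le,
          show (∫⁻ t in Ioo x d, f t) ^ q = (∫⁻ t in Ioo x d, f t) ^ r *
            (∫⁻ t in Ioo x d, f t) ^ (q - r) by
            rw [← ENNReal.rpow_add_of_nonneg _ _ hr0.le hqr.le, add_sub_cancel]]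
        ring

lemma Vr_of_lt_one {r : ℝ} (hr : r < 1) (v : ℝ → ℝ≥0∞) (x t : ℝ) :
    Vr r v x t = (∫⁻ s in Ioo x t, v s ^ (1 / (1 - r))) ^ ((1 - r) / r) := by
  rw [Vr, if_neg hr.ne]

lemma rpow_conj_mul_self (z : ℝ≥0∞) {r : ℝ} (hr0 : 0 < r) (hr1 : r < 1) :
    (z ^ (1 / (1 - r))) ^ r * z = z ^ (1 / (1 - r)) := by
  have hr1' : 0 < 1 - r := by linarith
  rw [← ENNReal.rpow_mul]
  nth_rewrite 2 [← ENNReal.rpow_one z]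
  rw [← ENNReal.rpow_add_of_nonneg _ _ (by positivity) zero_le_one]
  congr 1; field_simp; ring

/-- The conclusion `z ^ (s - 1) ≤ c` of `z ^ s ≤ c * z`. -/
lemma rpow_le_of_rpow_le_mul {z c : ℝ≥0∞} (hz : z ≠ ∞) {s e : ℝ} (he : 0 < e) (hs : s = e + 1)
    (h : z ^ s ≤ c * z) : z ^ e ≤ c := by
  rcases eq_or_ne z 0 with rfl | h0
  · rw [ENNReal.zero_rpow_of_pos he]; exact zero_le
  · rw [hs, ENNReal.rpow_add _ _ h0 hz, ENNReal.rpow_one] at h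
    exact (ENNReal.mul_le_mul_iff_left h0 hz).1 h

lemma necessity_left_exists (p q r : ℝ) (hr0 : 0 < r) (hrp : r < p) (hpq : p ≤ q) (hq1 : q < 1) :
    ∃ K : ℝ≥0∞, K ≠ ∞ ∧ ∀ (a b : ℝ) (u v w : ℝ → ℝ≥0∞) (C : ℝ≥0∞), Measurable u →
      Measurable v → Measurable w → (∫⁻ s in Ioo a b, u s ≠ ∞) →
      (∫⁻ s in Ioo a b, v s ^ (1 / (1 - r)) ≠ ∞) → CesCesIneq a b r p q u v w C →
      ∀ x ∈ Ioo a b, ∫⁻ s in Ioo x b, w s ≠ 0 → ∫⁻ s in Ioo x b, w s ≠ ∞ →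
        (∫⁻ t in Ioo x b, w t) ^ (-(1 / p)) *
          (∫⁻ t in Ioo x b, (∫⁻ s in Ioo t b, u s) ^ (q / (1 - q)) * u t *
            Vr r v x t ^ (q / (1 - q))) ^ ((1 - q) / q) ≤ K * C := by
  have hq1' : 0 < 1 - q := by linarith
  have hr1 : r < 1 := by linarith
  have hr1' : 0 < 1 - r := by linarith
  have hqr : 0 < q - r := by linarith
  have hq0 : 0 < q := by linarith
  have hp0 : 0 < p := by linarith
  set γ : ℝ := q / (1 - q) with hγ
  have hγpos : 0 < γ := by positivity
  have hγ1 : γ + 1 = 1 / (1 - q) := by rw [hγ]; field_simp; ring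
  set β : ℝ := (q - r) / (r * (1 - q)) with hβ
  have hβpos : 0 < β := by positivity
  have hβ1 : β + 1 = q * (1 - r) / (r * (1 - q)) := by rw [hβ]; field_simp; ring
  set c₀ := ENNReal.ofReal (β * r + 1)⁻¹ with hc₀
  have hc₀0 : c₀ ≠ 0 := by
    rw [hc₀, ← pos_iff_ne_zero, ENNReal.ofReal_pos]; positivity
  have hc₀t : c₀ ≠ ∞ := ENNReal.ofReal_ne_top
  set c₁ := ENNReal.ofReal (β + 1)⁻¹ * ENNReal.ofReal (γ + 1) with hc₁
  refine ⟨c₀ ^ (-(1 / r)) * c₁, by finiteness, fun a b u v w C hu hv hw hufin hσfin hC x hx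
    hw0 hwt => ?_⟩
  set σ : ℝ → ℝ≥0∞ := fun s => v s ^ (1 / (1 - r)) with hσ
  have hσm : Measurable σ := by fun_prop
  set S : ℝ → ℝ≥0∞ := fun t => ∫⁻ s in Ioo x t, σ s with hS
  have hSm : Measurable S := measurable_primitive σ x
  set U : ℝ → ℝ≥0∞ := fun t => ∫⁻ s in Ioo t b, u s with hU
  have hUm : Measurable U := measurable_tail u b
  have hσfin' : ∀ t ≤ b, S t ≠ ∞ := fun t ht =>
    ne_top_of_le_ne_top hσfin (lintegral_mono_set (Ioo_subset_Ioo hx.1.le ht))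
  have hufin' : ∀ t, a ≤ t → U t ≠ ∞ := fun t ht =>
    ne_top_of_le_ne_top hufin (lintegral_mono_set (Ioo_subset_Ioo_left ht))
  set A := ∫⁻ t in Ioo x b, (u t * U t ^ γ) * S t ^ (β + 1) with hA
  have hAeq : ∫⁻ t in Ioo x b, U t ^ γ * u t * Vr r v x t ^ γ = A := by
    refine lintegral_congr fun t => ?_
    rw [Vr_of_lt_one hr1, rpow_rpow_of_mul _ (c := β + 1) (by rw [hβ1, hγ]; field_simp)]
    ring
  have hAtop : A ≠ ∞ := by
    have hle : A ≤ ∫⁻ t in Ioo x b, (u t * U x ^ γ) * S b ^ (β + 1) := by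
      refine setLIntegral_mono' measurableSet_Ioo fun t ht => ?_
      have h1 : U t ≤ U x := lintegral_mono_set (Ioo_subset_Ioo_left ht.1.le)
      have h2 : S t ≤ S b := lintegral_mono_set (Ioo_subset_Ioo_right ht.2.le)
      gcongr
    rw [lintegral_mul_const _ (by fun_prop), lintegral_mul_const _ (by fun_prop)] at hle
    have h1 := hufin' x hx.1.le
    have h2 := hσfin' b le_rfl
    exact ne_top_of_le_ne_top (by finiteness) hle
  set g : ℝ → ℝ≥0∞ := fun t => (σ t * S t ^ β) * U t ^ (γ + 1) with hg
  have hgm : Measurable g := by fun_prop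
  have hgA : ∫⁻ t in Ioo x b, g t = c₁ * A := by
    have h := lintegral_primitive_rpow_mul_tail_rpow hσm hu (hσfin' b le_rfl) (hufin' x hx.1.le)
      (β := β) (γ := γ) (by linarith) (by linarith)
    calc _ = (∫⁻ t in Ioo x b, (σ t * S t ^ β) * U t ^ (γ + 1)) *
          (ENNReal.ofReal (γ + 1)⁻¹ * ENNReal.ofReal (γ + 1)) := by
          rw [ofReal_inv_mul_cancel (by linarith), mul_one]
      _ = _ := by rw [← mul_assoc, h, hc₁]; ring
  have key := hC ((Ioo x b).indicator g) (hgm.indicator measurableSet_Ioo)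
  have hright : (∫⁻ t in Ioo a b, (∫⁻ s in Ioo a t, (Ioo x b).indicator g s) ^ p * w t) ≤
      (c₁ * A) ^ p * ∫⁻ t in Ioo x b, w t := by
    rw [← lintegral_const_mul _ hw]
    calc _ ≤ ∫⁻ t in Ioo a b, (Ioo x b).indicator (fun t => (c₁ * A) ^ p * w t) t := by
          refine setLIntegral_mono' measurableSet_Ioo fun t ht => ?_
          rw [setLIntegral_indicator measurableSet_Ioo, Ioo_inter_Ioo, sup_of_le_left hx.1.le,
            inf_of_le_right ht.2.le]
          by_cases hxt : x < t
          · rw [indicator_of_mem (show t ∈ Ioo x b from ⟨hxt, ht.2⟩)]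
            gcongr
            rw [← hgA]
            exact lintegral_mono_set (Ioo_subset_Ioo_right ht.2.le)
          · rw [Ioo_eq_empty hxt, Measure.restrict_empty, lintegral_zero_measure,
              ENNReal.zero_rpow_of_pos hp0, zero_mul]
            exact zero_le
      _ = _ := by
          rw [setLIntegral_indicator measurableSet_Ioo,
            inter_eq_left.2 (Ioo_subset_Ioo_left hx.1.le)]
  have hleft : c₀ ^ (q / r) * A ≤
      ∫⁻ t in Ioo a b, (∫⁻ s in Ioo a t, ((Ioo x b).indicator g s) ^ r * v s) ^ (q / r) * u t := by
    rw [hA, ← lintegral_const_mul _ (by fun_prop)]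
    refine le_trans (setLIntegral_mono' measurableSet_Ioo fun t ht => ?_)
      (lintegral_mono_set (Ioo_subset_Ioo_left hx.1.le))
    have h1 : U t ^ ((γ + 1) * r) * (S t ^ (β * r + 1) * c₀) ≤
        ∫⁻ s in Ioo a t, ((Ioo x b).indicator g s) ^ r * v s := by
      rw [hc₀, ← lintegral_primitive_rpow hσm (hσfin' t ht.2.le)
        (by have := mul_pos hβpos hr0; linarith),
        ← lintegral_const_mul _ (by exact hσm.mul (hSm.pow_const _))]
      refine le_trans (setLIntegral_mono' measurableSet_Ioo fun s hs => ?_)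
        (lintegral_mono_set (Ioo_subset_Ioo_left hx.1.le))
      rw [indicator_of_mem (show s ∈ Ioo x b from ⟨hs.1, hs.2.trans ht.2⟩), hg]
      have h2 : U t ≤ U s := lintegral_mono_set (Ioo_subset_Ioo_left hs.2.le)
      calc _ ≤ U s ^ ((γ + 1) * r) * (σ s * S s ^ (β * r)) := by gcongr
        _ = U s ^ ((γ + 1) * r) * ((σ s ^ r * v s) * S s ^ (β * r)) := by
            rw [hσ, rpow_conj_mul_self _ hr0 hr1]
        _ = _ := by
            rw [ENNReal.mul_rpow_of_nonneg _ _ hr0.le, ENNReal.mul_rpow_of_nonneg _ _ hr0.le,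
              ENNReal.rpow_mul, ENNReal.rpow_mul]
            ring
    calc _ = (U t ^ ((γ + 1) * r) * (S t ^ (β * r + 1) * c₀)) ^ (q / r) * u t := by
          rw [ENNReal.mul_rpow_of_nonneg _ _ (by positivity),
            ENNReal.mul_rpow_of_nonneg _ _ (by positivity),
            rpow_rpow_of_mul _ (c := γ) (by rw [hγ1, hγ]; field_simp),
            rpow_rpow_of_mul _ (c := β + 1) (by rw [hβ]; field_simp; ring)]
          ring
      _ ≤ _ := by gcongr
  have hcomb : c₀ ^ (1 / r) * A ^ (1 / q) ≤ C * (c₁ * A * (∫⁻ t in Ioo x b, w t) ^ (1 / p)) := by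
    calc _ = (c₀ ^ (q / r) * A) ^ (1 / q) := by
          rw [ENNReal.mul_rpow_of_nonneg _ _ (by positivity),
            rpow_rpow_of_mul _ (c := 1 / r) (by field_simp)]
      _ ≤ _ := ENNReal.rpow_le_rpow hleft (by positivity)
      _ ≤ _ := key
      _ ≤ C * ((c₁ * A) ^ p * ∫⁻ t in Ioo x b, w t) ^ (1 / p) := by gcongr
      _ = _ := by
          rw [ENNReal.mul_rpow_of_nonneg _ _ (by positivity),
            rpow_rpow_of_mul (c₁ * A) (c := 1) (by field_simp), ENNReal.rpow_one]
  rw [hAeq]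
  have hfin : A ^ ((1 - q) / q) ≤ c₀ ^ (-(1 / r)) * c₁ * C * (∫⁻ t in Ioo x b, w t) ^ (1 / p) := by
    refine rpow_le_of_rpow_le_mul hAtop (s := 1 / q) (by positivity) (by field_simp; ring) ?_
    calc A ^ (1 / q) = c₀ ^ (-(1 / r)) * (c₀ ^ (1 / r) * A ^ (1 / q)) := by
          rw [← mul_assoc, rpow_mul_rpow_of_add hc₀0 hc₀t (neg_add_cancel _), ENNReal.rpow_zero,
            one_mul]
      _ ≤ _ := mul_le_mul_right hcomb _
      _ = _ := by ring
  calc _ ≤ (∫⁻ t in Ioo x b, w t) ^ (-(1 / p)) *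
        (c₀ ^ (-(1 / r)) * c₁ * C * (∫⁻ t in Ioo x b, w t) ^ (1 / p)) := mul_le_mul_right hfin _
    _ = c₀ ^ (-(1 / r)) * c₁ * C *
        ((∫⁻ t in Ioo x b, w t) ^ (-(1 / p)) * (∫⁻ t in Ioo x b, w t) ^ (1 / p)) := by ring
    _ = _ := by
        rw [rpow_mul_rpow_of_add hw0 hwt (neg_add_cancel _), ENNReal.rpow_zero, mul_one]

lemma rpow_anti_of_nonpos {x y : ℝ≥0∞} {z : ℝ} (hz : z ≤ 0) (h : x ≤ y) : y ^ z ≤ x ^ z := by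
  rw [← neg_neg z, ENNReal.rpow_neg, ENNReal.rpow_neg x, ENNReal.inv_le_inv]
  exact ENNReal.rpow_le_rpow h (by linarith)

lemma mul_rpow_le_of_mul_rpow_le {z y c : ℝ≥0∞} (hz : z ≠ ∞) {s₁ s₂ e : ℝ} (he : 0 < e)
    (hs : s₁ = e + s₂) (h : y * z ^ s₁ ≤ c * z ^ s₂) : y * z ^ e ≤ c := by
  rcases eq_or_ne z 0 with rfl | h0
  · rw [ENNReal.zero_rpow_of_pos he, mul_zero]; exact zero_le
  · rw [hs, ENNReal.rpow_add _ _ h0 hz, ← mul_assoc] at h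
    have h1 : z ^ s₂ ≠ 0 := by
      rw [Ne, ENNReal.rpow_eq_zero_iff]; tauto
    exact (ENNReal.mul_le_mul_iff_left h1 (ENNReal.rpow_ne_top_of_ne_zero h0 hz)).1 h

lemma necessity_right_exists (p q r : ℝ) (hr0 : 0 < r) (hrp : r < p) (hpq : p ≤ q) (hq1 : q < 1) :
    ∃ K : ℝ≥0∞, K ≠ ∞ ∧ ∀ (a b : ℝ) (u v w : ℝ → ℝ≥0∞) (C : ℝ≥0∞), Measurable u →
      Measurable v → Measurable w →
      (∫⁻ s in Ioo a b, v s ^ (1 / (1 - r)) ≠ ∞) →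
      (∀ x ∈ Ioo a b, ∫⁻ s in Ioo x b, w s ≠ 0) → (∀ x ∈ Ioo a b, ∫⁻ s in Ioo x b, w s ≠ ∞) →
      CesCesIneq a b r p q u v w C →
      ∀ x ∈ Ioo a b, (∫⁻ t in Ioo x b, u t) ^ (1 / q) *
        (∫⁻ t in Ioo a x, (∫⁻ s in Ioo t b, w s) ^ (-(p / (p - r))) * w t *
          Vr r v t x ^ (p * r / (p - r))) ^ ((p - r) / (p * r)) ≤ K * C := by
  have hr1 : r < 1 := by linarith
  have hr1' : 0 < 1 - r := by linarith
  have hq0 : 0 < q := by linarith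
  have hp0 : 0 < p := by linarith
  have hp1' : 0 < 1 - p := by linarith
  have hpr : 0 < p - r := by linarith
  set θ : ℝ := r / (p - r) with hθ
  have hθpos : 0 < θ := by positivity
  have hθ1 : -(p / (p - r)) = -1 - θ := by rw [hθ]; field_simp; ring
  set κ : ℝ := p * (1 - r) / (p - r) with hκ
  have hκpos : 0 < κ := by positivity
  set m : ℝ := (1 - r) / (p - r) with hm
  have hmpos : 0 < m := by positivity
  have hm1 : m - 1 = (1 - p) / (p - r) := by rw [hm]; field_simp; ring
  have hm1pos : 0 < m - 1 := by rw [hm1]; positivity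
  have hκ1 : (m - 1) * r = κ - 1 := by rw [hm1, hκ]; field_simp; ring
  have hκ1pos : 0 < κ - 1 := by rw [← hκ1]; positivity
  have hr1i : 0 < 1 / r - 1 := by rw [sub_pos, lt_div_iff₀ hr0]; linarith
  have hprp : 0 < p / r - 1 := by rw [sub_pos, lt_div_iff₀ hr0]; linarith
  set cκ := ENNReal.ofReal κ⁻¹ with hcκ
  have hcκ0 : cκ ≠ 0 := by
    rw [hcκ, ← pos_iff_ne_zero, ENNReal.ofReal_pos]; positivity
  have hcκt : cκ ≠ ∞ := ENNReal.ofReal_ne_top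
  set cr := ENNReal.ofReal (1 / r)⁻¹ with hcr
  have hcr0 : cr ≠ 0 := by
    rw [hcr, ← pos_iff_ne_zero, ENNReal.ofReal_pos]; positivity
  have hcrt : cr ≠ ∞ := ENNReal.ofReal_ne_top
  set cF := ENNReal.ofReal (1 / r) * ENNReal.ofReal m⁻¹ with hcF
  set cG := ENNReal.ofReal p * cr ^ (p - 1) with hcG
  set cY := ENNReal.ofReal θ⁻¹ with hcY
  set cR := cF ^ p * (cG * cY ^ (p / r - 1)) with hcR
  have hcRt : cR ≠ ∞ := by finiteness
  refine ⟨cκ ^ (-(1 / r)) * cR ^ (1 / p), by finiteness, fun a b u v w C hu hv hw hσfin hw0 hwt hC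
    x hx => ?_⟩
  set σ : ℝ → ℝ≥0∞ := fun s => v s ^ (1 / (1 - r)) with hσ
  have hσm : Measurable σ := by fun_prop
  set S : ℝ → ℝ≥0∞ := fun t => ∫⁻ s in Ioo t x, σ s with hS
  have hSm : Measurable S := measurable_tail σ x
  set W : ℝ → ℝ≥0∞ := fun t => ∫⁻ s in Ioo t b, w s with hW
  have hWm : Measurable W := measurable_tail w b
  set η : ℝ → ℝ≥0∞ := fun t => w t * W t ^ (-1 - θ) with hη
  have hηm : Measurable η := by fun_prop
  set Y : ℝ → ℝ≥0∞ := fun t => ∫⁻ s in Ioo a t, η s with hY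
  have hYm : Measurable Y := measurable_primitive η a
  have hSle : ∀ t, a ≤ t → S t ≤ S a := fun t ht => lintegral_mono_set (Ioo_subset_Ioo_left ht)
  have hSa : S a ≠ ∞ :=
    ne_top_of_le_ne_top hσfin (lintegral_mono_set (Ioo_subset_Ioo_right hx.2.le))
  have hSt : ∀ t, a ≤ t → S t ≠ ∞ := fun t ht => ne_top_of_le_ne_top hSa (hSle t ht)
  have hSx : ∀ t, x ≤ t → S t = 0 := fun t ht => by
    rw [hS]; simp only
    rw [Ioo_eq_empty (not_lt.2 ht), Measure.restrict_empty, lintegral_zero_measure]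
  have hYle : ∀ t ∈ Ioo a b, Y t ≤ W t ^ (-θ) * cY := fun t ht =>
    lintegral_tail_rpow_neg_le hw ht.2.le hwt hθpos
  have hYt : ∀ t ∈ Ioo a b, Y t ≠ ∞ := fun t ht =>
    ne_top_of_le_ne_top (ENNReal.mul_ne_top
      (ENNReal.rpow_ne_top_of_ne_zero (hw0 t ht) (hwt t ht)) ENNReal.ofReal_ne_top) (hYle t ht)
  set B := ∫⁻ t in Ioo a x, η t * S t ^ κ with hB
  have hBeq :
      ∫⁻ t in Ioo a x, W t ^ (-(p / (p - r))) * w t * Vr r v t x ^ (p * r / (p - r)) = B := by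
    refine lintegral_congr fun t => ?_
    rw [Vr_of_lt_one hr1, rpow_rpow_of_mul _ (c := κ) (by rw [hκ]; field_simp), hθ1,
      mul_comm (W t ^ _)]
  have hBt : B ≠ ∞ := by
    have hle : B ≤ ∫⁻ t in Ioo a x, η t * S a ^ κ := by
      refine setLIntegral_mono' measurableSet_Ioo fun t ht => ?_
      have := hSle t ht.1.le
      gcongr
    rw [lintegral_mul_const _ hηm] at hle
    exact ne_top_of_le_ne_top (ENNReal.mul_ne_top (hYt x hx)
      (ENNReal.rpow_ne_top_of_nonneg hκpos.le hSa)) hle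
  set f : ℝ → ℝ≥0∞ := fun t => (σ t * S t ^ (m - 1)) * Y t ^ (1 / r) with hf
  have hfm : Measurable f := by fun_prop
  have hY1 : ∀ t ∈ Ioo a b, ∫⁻ s in Ioo a t, η s * Y s ^ (1 / r - 1) = Y t ^ (1 / r) * cr := by
    intro t ht
    rw [lintegral_primitive_rpow hηm (hYt t ht) (by linarith), sub_add_cancel]
  have hfr : ∫⁻ s in Ioo a x, f s ^ r * v s = B * cκ := by
    have h := lintegral_mul_tail_eq (h := η) (k := fun s => σ s * S s ^ (κ - 1)) hηm
      (by fun_prop) a x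
    rw [hB, ← lintegral_mul_const _ (by fun_prop)]
    calc _ = ∫⁻ t in Ioo a x, (σ t * S t ^ (κ - 1)) * Y t := by
          refine lintegral_congr fun t => ?_
          rw [hf]
          simp only
          rw [ENNReal.mul_rpow_of_nonneg _ _ hr0.le, ENNReal.mul_rpow_of_nonneg _ _ hr0.le,
            rpow_rpow_of_mul _ hκ1, rpow_rpow_of_mul (Y t) (c := 1) (by field_simp),
            ENNReal.rpow_one]
          calc _ = (σ t ^ r * v t) * S t ^ (κ - 1) * Y t := by ring
            _ = _ := by rw [hσ, rpow_conj_mul_self _ hr0 hr1]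
      _ = _ := h.symm
      _ = _ := by
          refine setLIntegral_congr_fun measurableSet_Ioo fun t ht => ?_
          have h5 := lintegral_tail_rpow hσm (hSt t ht.1.le) (β := κ - 1) (by linarith)
          rw [sub_add_cancel] at h5
          exact (congrArg (fun z => η t * z) h5).trans (mul_assoc _ _ _).symm
  have hleft : (B * cκ) ^ (q / r) * ∫⁻ t in Ioo x b, u t ≤
      ∫⁻ t in Ioo a b, (∫⁻ s in Ioo a t, f s ^ r * v s) ^ (q / r) * u t := by
    rw [← lintegral_const_mul _ hu]
    refine le_trans (setLIntegral_mono' measurableSet_Ioo fun t ht => ?_)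
      (lintegral_mono_set (Ioo_subset_Ioo_left hx.1.le))
    gcongr
    rw [← hfr]
    exact lintegral_mono_set (Ioo_subset_Ioo_right ht.1.le)
  set ψ : ℝ → ℝ≥0∞ := fun t => (η t * Y t ^ (1 / r - 1)) * S t ^ m with hψ
  have hψm : Measurable ψ := by fun_prop
  set G : ℝ → ℝ≥0∞ := fun t => ∫⁻ s in Ioo a t, ψ s with hG
  have hGm : Measurable G := measurable_primitive ψ a
  have hFG : ∀ t ∈ Ioo a b, ∫⁻ s in Ioo a t, f s ≤ cF * G t := by
    intro t ht
    have h := lintegral_mul_tail_eq (h := fun s => η s * Y s ^ (1 / r - 1))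
      (k := fun s => σ s * S s ^ (m - 1)) (by fun_prop) (by fun_prop) a t
    have hY1m : Measurable fun s => ∫⁻ y in Ioo a s, η y * Y y ^ (1 / r - 1) :=
      measurable_primitive _ _
    have hker : ∀ y ∈ Ioo a t, ∫⁻ s in Ioo y t, σ s * S s ^ (m - 1) ≤
        S y ^ m * ENNReal.ofReal m⁻¹ := by
      intro y hy
      have h2 := lintegral_tail_rpow hσm (hSt y hy.1.le) (β := m - 1) (by linarith)
      rw [sub_add_cancel] at h2
      rw [hS, ← h2]
      have h3 : ∀ s, σ s * S s ^ (m - 1) = (Iio x).indicator (fun s => σ s * S s ^ (m - 1)) s := by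
        intro s
        by_cases hs : s < x
        · rw [indicator_of_mem (show s ∈ Iio x from hs)]
        · rw [indicator_of_notMem (show s ∉ Iio x from hs), hSx s (not_lt.1 hs),
            ENNReal.zero_rpow_of_pos hm1pos, mul_zero]
      calc _ = ∫⁻ s in Ioo y t, (Iio x).indicator (fun s => σ s * S s ^ (m - 1)) s :=
            lintegral_congr h3
        _ ≤ _ := by
            rw [setLIntegral_indicator measurableSet_Iio]
            exact lintegral_mono_set fun s hs => ⟨hs.2.1, hs.1⟩
    calc ∫⁻ s in Ioo a t, f s = ∫⁻ s in Ioo a t, ENNReal.ofReal (1 / r) *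
          ((σ s * S s ^ (m - 1)) * ∫⁻ y in Ioo a s, η y * Y y ^ (1 / r - 1)) := by
          refine setLIntegral_congr_fun measurableSet_Ioo fun s hs => ?_
          rw [hY1 s ⟨hs.1, hs.2.trans ht.2⟩]
          calc f s = f s * (ENNReal.ofReal (1 / r)⁻¹ * ENNReal.ofReal (1 / r)) := by
                rw [ofReal_inv_mul_cancel (by positivity), mul_one]
            _ = _ := by rw [hf, hcr]; ring
      _ = ENNReal.ofReal (1 / r) * ∫⁻ s in Ioo a t, (η s * Y s ^ (1 / r - 1)) *
            ∫⁻ y in Ioo s t, σ y * S y ^ (m - 1) := by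
          rw [lintegral_const_mul _ (by fun_prop), ← h]
      _ ≤ ENNReal.ofReal (1 / r) * ∫⁻ s in Ioo a t, (η s * Y s ^ (1 / r - 1)) *
            (S s ^ m * ENNReal.ofReal m⁻¹) :=
          mul_le_mul_right (setLIntegral_mono' measurableSet_Ioo fun y hy =>
            mul_le_mul_right (hker y hy) _) _
      _ = _ := by
          simp only [← mul_assoc]
          rw [lintegral_mul_const _ (by fun_prop), hcF, hG]
          simp only [hψ]
          ring
  have hGt : ∀ t ∈ Ioo a b, G t ≠ ∞ := by
    intro t ht
    have hle : G t ≤ ∫⁻ s in Ioo a t, (η s * Y s ^ (1 / r - 1)) * S a ^ m := by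
      refine setLIntegral_mono' measurableSet_Ioo fun s hs => ?_
      have := hSle s hs.1.le
      rw [hψ]
      beta_reduce
      gcongr
    rw [lintegral_mul_const _ (by fun_prop), hY1 t ht] at hle
    have := hYt t ht
    exact ne_top_of_le_ne_top (by finiteness) hle
  have hGp : ∀ t ∈ Ioo a b, G t ^ p ≤
      cG * ∫⁻ s in Ioo a t, η s * S s ^ κ * Y s ^ (p / r - 1) := by
    intro t ht
    have h := lintegral_primitive_rpow hψm (hGt t ht) (β := p - 1) (by linarith)
    rw [sub_add_cancel] at h
    have h2 : ∫⁻ s in Ioo a t, ψ s * (∫⁻ y in Ioo a s, ψ y) ^ (p - 1) ≤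
        ∫⁻ s in Ioo a t, cr ^ (p - 1) * (η s * S s ^ κ * Y s ^ (p / r - 1)) := by
      refine setLIntegral_mono' measurableSet_Ioo fun s hs => ?_
      have hsb : s ∈ Ioo a b := ⟨hs.1, hs.2.trans ht.2⟩
      rcases eq_or_ne (S s) 0 with hS0 | hS0
      · rw [hψ]; simp only
        rw [hS0, ENNReal.zero_rpow_of_pos hmpos, mul_zero, zero_mul]
        exact zero_le
      rcases eq_or_ne (Y s) 0 with hY0 | hY0
      · rw [hψ]; simp only
        rw [hY0, ENNReal.zero_rpow_of_pos hr1i, mul_zero, zero_mul, zero_mul]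
        exact zero_le
      have hlow : S s ^ m * (Y s ^ (1 / r) * cr) ≤ ∫⁻ y in Ioo a s, ψ y := by
        rw [← hY1 s hsb, ← lintegral_const_mul _ (by fun_prop)]
        refine setLIntegral_mono' measurableSet_Ioo fun y hy => ?_
        have h4 : S s ≤ S y := lintegral_mono_set (Ioo_subset_Ioo_left hy.2.le)
        rw [mul_comm, hψ]
        beta_reduce
        gcongr
      have hSst := hSt s hs.1.le
      have hYst := hYt s hsb
      calc _ ≤ ψ s * (S s ^ m * (Y s ^ (1 / r) * cr)) ^ (p - 1) :=
            mul_le_mul_right (rpow_anti_of_nonpos (by linarith) hlow) _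
        _ = _ := by
            have n1 : S s ^ m ≠ 0 := by rw [Ne, ENNReal.rpow_eq_zero_iff]; tauto
            have n2 : Y s ^ (1 / r) ≠ 0 := by rw [Ne, ENNReal.rpow_eq_zero_iff]; tauto
            have t1 : S s ^ m ≠ ∞ := by finiteness
            have t2 : Y s ^ (1 / r) ≠ ∞ := by finiteness
            rw [ENNReal.mul_rpow_of_ne_zero n1 (mul_ne_zero n2 hcr0),
              ENNReal.mul_rpow_of_ne_zero n2 hcr0, hψ, ← ENNReal.rpow_mul, ← ENNReal.rpow_mul]
            calc _ = cr ^ (p - 1) * (η s * (S s ^ m * S s ^ (m * (p - 1))) *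
                  (Y s ^ (1 / r - 1) * Y s ^ (1 / r * (p - 1)))) := by ring
              _ = _ := by
                  rw [rpow_mul_rpow_of_add hS0 hSst (c := κ) (by rw [hm, hκ]; ring),
                    rpow_mul_rpow_of_add hY0 hYst (c := p / r - 1) (by ring)]
    rw [lintegral_const_mul _ (by fun_prop)] at h2
    calc G t ^ p = ENNReal.ofReal p * (G t ^ p * ENNReal.ofReal p⁻¹) := by
          rw [mul_comm, mul_assoc, ofReal_inv_mul_cancel hp0, mul_one]
      _ ≤ _ := by
          rw [hG, ← h, hcG, mul_assoc]
          exact mul_le_mul_right h2 _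
  have hright : (∫⁻ t in Ioo a b, (∫⁻ s in Ioo a t, f s) ^ p * w t) ≤ cR * B := by
    set φ : ℝ → ℝ≥0∞ := fun s => η s * S s ^ κ * Y s ^ (p / r - 1) with hφ
    have hφm : Measurable φ := by fun_prop
    have hφp : Measurable fun t => ∫⁻ s in Ioo a t, φ s := measurable_primitive _ _
    have hpt : ∀ s ∈ Ioo a b, φ s * W s ≤
        cY ^ (p / r - 1) * (Iio x).indicator (fun s => η s * S s ^ κ) s := by
      intro s hs
      by_cases hsx : s < x
      · rw [indicator_of_mem (show s ∈ Iio x from hsx)]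
        calc φ s * W s ≤ η s * S s ^ κ * (W s ^ (-θ) * cY) ^ (p / r - 1) * W s := by
              rw [hφ]
              beta_reduce
              have := hYle s hs
              gcongr
          _ = η s * S s ^ κ * cY ^ (p / r - 1) * (W s ^ (-1 : ℝ) * W s ^ (1 : ℝ)) := by
              rw [ENNReal.mul_rpow_of_nonneg _ _ hprp.le,
                rpow_rpow_of_mul _ (c := -1) (by rw [hθ]; field_simp), ENNReal.rpow_one]
              ring
          _ = _ := by
              rw [rpow_mul_rpow_of_add (hw0 s hs) (hwt s hs) (neg_add_cancel _), ENNReal.rpow_zero]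
              ring
      · rw [hφ]
        simp only
        rw [hSx s (not_lt.1 hsx), ENNReal.zero_rpow_of_pos hκpos, mul_zero, zero_mul, zero_mul]
        exact zero_le
    calc _ ≤ ∫⁻ t in Ioo a b, (cF ^ p * cG) * (w t * ∫⁻ s in Ioo a t, φ s) := by
          refine setLIntegral_mono' measurableSet_Ioo fun t ht => ?_
          calc _ ≤ (cF * G t) ^ p * w t := by
                have := hFG t ht
                gcongr
            _ = cF ^ p * w t * G t ^ p := by
                rw [ENNReal.mul_rpow_of_nonneg _ _ hp0.le]; ring
            _ ≤ cF ^ p * w t * (cG * ∫⁻ s in Ioo a t, φ s) := mul_le_mul_right (hGp t ht) _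
            _ = _ := by ring
      _ = (cF ^ p * cG) * ∫⁻ s in Ioo a b, φ s * W s := by
          rw [lintegral_const_mul _ (by fun_prop), lintegral_mul_tail_eq hφm hw]
      _ ≤ (cF ^ p * cG) * ∫⁻ s in Ioo a b,
            cY ^ (p / r - 1) * (Iio x).indicator (fun s => η s * S s ^ κ) s :=
          mul_le_mul_right (setLIntegral_mono' measurableSet_Ioo hpt) _
      _ = _ := by
          rw [lintegral_const_mul _ (Measurable.indicator (by fun_prop) measurableSet_Iio),
            setLIntegral_indicator measurableSet_Iio, hB, hcR,
            show Iio x ∩ Ioo a b = Ioo a x by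
              ext s
              simp only [mem_inter_iff, mem_Iio, mem_Ioo]
              exact ⟨fun h => ⟨h.2.1, h.1⟩, fun h => ⟨h.2, h.1, h.2.trans hx.2⟩⟩]
          ring
  have key := hC f hfm
  rw [hBeq]
  refine mul_rpow_le_of_mul_rpow_le hBt (s₁ := 1 / r) (s₂ := 1 / p) (by positivity)
    (by field_simp; ring) ?_
  calc _ = cκ ^ (-(1 / r)) * (((B * cκ) ^ (q / r) * ∫⁻ t in Ioo x b, u t) ^ (1 / q)) := by
        rw [ENNReal.mul_rpow_of_nonneg _ _ (by positivity),
          ENNReal.mul_rpow_of_nonneg _ _ (by positivity),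
          ENNReal.mul_rpow_of_nonneg _ _ (by positivity),
          rpow_rpow_of_mul _ (c := 1 / r) (by field_simp),
          rpow_rpow_of_mul _ (c := 1 / r) (by field_simp)]
        calc _ = (∫⁻ t in Ioo x b, u t) ^ (1 / q) * B ^ (1 / r) *
              (cκ ^ (-(1 / r)) * cκ ^ (1 / r)) := by
              rw [rpow_mul_rpow_of_add hcκ0 hcκt (neg_add_cancel _), ENNReal.rpow_zero, mul_one]
          _ = _ := by ring
    _ ≤ cκ ^ (-(1 / r)) * (C * (cR * B) ^ (1 / p)) := by
        refine mul_le_mul_right ?_ _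
        refine (ENNReal.rpow_le_rpow hleft (by positivity)).trans (key.trans ?_)
        exact mul_le_mul_right (ENNReal.rpow_le_rpow hright (by positivity)) _
    _ = _ := by
        rw [ENNReal.mul_rpow_of_nonneg _ _ (by positivity)]
        ring

lemma add_rpow_le_two_rpow_mul (x y : ℝ≥0∞) {e : ℝ} (he : 0 ≤ e) :
    (x + y) ^ e ≤ 2 ^ e * (x ^ e + y ^ e) := by
  have h : x + y ≤ 2 * max x y := by
    rw [two_mul]; exact add_le_add (le_max_left _ _) (le_max_right _ _)
  calc (x + y) ^ e ≤ (2 * max x y) ^ e := ENNReal.rpow_le_rpow h he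
    _ = 2 ^ e * (max x y) ^ e := ENNReal.mul_rpow_of_nonneg _ _ he
    _ ≤ _ := by
      refine mul_le_mul_right ?_ _
      rcases max_cases x y with ⟨h, _⟩ | ⟨h, _⟩ <;> rw [h]
      · exact le_self_add
      · exact le_add_self

lemma right_bound_exists (p q r : ℝ) (hr0 : 0 < r) (hrp : r < p) (hpq : p ≤ q) (hq1 : q < 1) :
    ∃ K : ℝ≥0∞, K ≠ ∞ ∧ ∀ (a b : ℝ) (u v w : ℝ → ℝ≥0∞), Measurable u →
      Measurable v → Measurable w → (∫⁻ s in Ioo a b, u s ≠ ∞) →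
      (∫⁻ s in Ioo a b, v s ^ (1 / (1 - r)) ≠ ∞) →
      (∀ x ∈ Ioo a b, ∫⁻ s in Ioo x b, w s ≠ 0) → (∀ x ∈ Ioo a b, ∫⁻ s in Ioo x b, w s ≠ ∞) →
      ∀ c ∈ Ioo a b, ∀ x ∈ Ioo a b, c ≤ x →
      (∫⁻ t in Ioo x b, u t) ^ (1 / q) *
        (∫⁻ s in Ioo c x, (∫⁻ t in Ioo s b, w t) ^ (-(r / (p - r))) *
          (v s ^ (1 / (1 - r)) * (∫⁻ t in Ioo s x, v t ^ (1 / (1 - r))) ^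
            (p * (1 - r) / (p - r) - 1))) ^ ((p - r) / (p * r)) ≤
        K * (C₂ a b r p q u v w + C₃ a b r p q u v w) := by
  have hr1 : r < 1 := by linarith
  have hr1' : 0 < 1 - r := by linarith
  have hq1' : 0 < 1 - q := by linarith
  have hq0 : 0 < q := by linarith
  have hp0 : 0 < p := by linarith
  have hpr : 0 < p - r := by linarith
  set γ : ℝ := q / (1 - q) with hγ
  have hγpos : 0 < γ := by positivity
  have hγ1 : γ + 1 = 1 / (1 - q) := by rw [hγ]; field_simp; ring
  set θ : ℝ := r / (p - r) with hθ
  have hθpos : 0 < θ := by positivity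
  have hθ1 : -(p / (p - r)) = -1 - θ := by rw [hθ]; field_simp; ring
  set κ : ℝ := p * (1 - r) / (p - r) with hκ
  have hκpos : 0 < κ := by positivity
  set e : ℝ := (p - r) / (p * r) with he
  have hepos : 0 < e := by positivity
  set cγ := ENNReal.ofReal (γ + 1)⁻¹ with hcγ
  have hcγ0 : cγ ≠ 0 := by
    rw [hcγ, ← pos_iff_ne_zero, ENNReal.ofReal_pos]; positivity
  have hcγt : cγ ≠ ∞ := ENNReal.ofReal_ne_top
  set cκ := ENNReal.ofReal κ⁻¹ with hcκ
  have hcκt : cκ ≠ ∞ := ENNReal.ofReal_ne_top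
  set K₁ := cγ ^ (-((1 - q) / q)) * cκ ^ e with hK₁
  set K₂ := (ENNReal.ofReal θ * cκ) ^ e with hK₂
  refine ⟨2 ^ e * (K₁ + K₂), by finiteness, fun a b u v w hu hv hw hufin hσfin hw0 hwt c hc x hx
    hcx => ?_⟩
  set σ : ℝ → ℝ≥0∞ := fun s => v s ^ (1 / (1 - r)) with hσ
  have hσm : Measurable σ := by fun_prop
  set S : ℝ → ℝ≥0∞ := fun t => ∫⁻ s in Ioo t x, σ s with hS
  have hSm : Measurable S := measurable_tail σ x
  set W : ℝ → ℝ≥0∞ := fun t => ∫⁻ s in Ioo t b, w s with hW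
  have hWm : Measurable W := measurable_tail w b
  have hSt : ∀ t, a ≤ t → S t ≠ ∞ := fun t ht =>
    ne_top_of_le_ne_top hσfin (lintegral_mono_set (Ioo_subset_Ioo ht hx.2.le))
  set U : ℝ → ℝ≥0∞ := fun t => ∫⁻ s in Ioo t b, u s with hU
  have hUt : U x ≠ ∞ := ne_top_of_le_ne_top hufin (lintegral_mono_set (Ioo_subset_Ioo_left hx.1.le))
  have hSκ : ∀ s ∈ Ioo c x, ∫⁻ t in Ioo s x, σ t * S t ^ (κ - 1) = S s ^ κ * cκ := by
    intro s hs
    have h := lintegral_tail_rpow hσm (hSt s (hc.1.le.trans hs.1.le)) (β := κ - 1) (by linarith)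
    rwa [sub_add_cancel] at h
  set η : ℝ → ℝ≥0∞ := fun t => w t * W t ^ (-1 - θ) with hη
  have hηm : Measurable η := by fun_prop
  set B := ∫⁻ t in Ioo c x, η t * S t ^ κ with hB
  have hsplit : ∫⁻ s in Ioo c x, W s ^ (-θ) * (σ s * S s ^ (κ - 1)) ≤
      W c ^ (-θ) * S c ^ κ * cκ + ENNReal.ofReal θ * cκ * B := by
    calc _ ≤ ∫⁻ s in Ioo c x, (W c ^ (-θ) + ENNReal.ofReal θ * ∫⁻ t in Ioo c s, η t) *
          (σ s * S s ^ (κ - 1)) := by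
          refine setLIntegral_mono' measurableSet_Ioo fun s hs => ?_
          refine mul_le_mul_left ?_ _
          exact tail_rpow_neg_le hw hs.1.le (hwt c hc)
            (hw0 s ⟨hc.1.trans hs.1, hs.2.trans hx.2⟩) hθpos
      _ = ∫⁻ s in Ioo c x, (W c ^ (-θ) * (σ s * S s ^ (κ - 1)) + ENNReal.ofReal θ *
            ((σ s * S s ^ (κ - 1)) * ∫⁻ t in Ioo c s, η t)) := by
          refine lintegral_congr fun s => ?_
          ring
      _ = W c ^ (-θ) * (∫⁻ s in Ioo c x, σ s * S s ^ (κ - 1)) + ENNReal.ofReal θ *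
            ∫⁻ s in Ioo c x, η s * ∫⁻ t in Ioo s x, σ t * S t ^ (κ - 1) := by
          have m1 : Measurable fun s => ∫⁻ t in Ioo c s, η t := measurable_primitive _ _
          rw [lintegral_add_left (by fun_prop), lintegral_const_mul _ (by fun_prop),
            lintegral_const_mul _ (by fun_prop),
            lintegral_mul_tail_eq (h := η) (k := fun s => σ s * S s ^ (κ - 1)) hηm (by fun_prop)]
      _ = _ := by
          have h := lintegral_tail_rpow hσm (hSt c hc.1.le) (β := κ - 1) (by linarith)
          rw [sub_add_cancel] at h
          congr 1
          · exact (congrArg (fun z => W c ^ (-θ) * z) h).trans (mul_assoc _ _ _).symm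
          · rw [mul_assoc]
            congr 1
            rw [hB, ← lintegral_const_mul _ (by fun_prop)]
            refine setLIntegral_congr_fun measurableSet_Ioo fun s hs => ?_
            refine (congrArg (fun z => η s * z) (hSκ s hs)).trans ?_
            ring
  have hfirst : U x ^ (1 / q) * (W c ^ (-θ) * S c ^ κ * cκ) ^ e ≤ K₁ * C₂ a b r p q u v w := by
    have hA : Vr r v c x ^ γ * (U x ^ (γ + 1) * cγ) ≤
        ∫⁻ t in Ioo c b, U t ^ γ * u t * Vr r v c t ^ γ := by
      rw [hcγ, ← lintegral_tail_rpow hu hUt (by linarith), ← lintegral_const_mul _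
        (by have hUm : Measurable U := measurable_tail u b
            exact hu.mul (hUm.pow_const _))]
      refine le_trans (setLIntegral_mono' measurableSet_Ioo fun t ht => ?_)
        (lintegral_mono_set (Ioo_subset_Ioo_left hcx))
      have h1 : Vr r v c x ≤ Vr r v c t := by
        rw [Vr_of_lt_one hr1, Vr_of_lt_one hr1]
        exact ENNReal.rpow_le_rpow (lintegral_mono_set (Ioo_subset_Ioo_right ht.1.le))
          (by positivity)
      calc _ = U t ^ γ * u t * Vr r v c x ^ γ := by rw [hU]; ring
        _ ≤ _ := by gcongr
    have hC2 : W c ^ (-(1 / p)) * (Vr r v c x ^ γ * (U x ^ (γ + 1) * cγ)) ^ ((1 - q) / q) ≤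
        C₂ a b r p q u v w := by
      refine le_trans ?_ (le_iSup₂_of_le c hc le_rfl)
      exact mul_le_mul_right (ENNReal.rpow_le_rpow hA (by positivity)) _
    calc _ = cγ ^ (-((1 - q) / q)) * cκ ^ e *
          (W c ^ (-(1 / p)) * (Vr r v c x ^ γ * (U x ^ (γ + 1) * cγ)) ^ ((1 - q) / q)) := by
          rw [ENNReal.mul_rpow_of_nonneg _ _ hepos.le, ENNReal.mul_rpow_of_nonneg _ _ hepos.le,
            ENNReal.mul_rpow_of_nonneg _ _ (by positivity),
            ENNReal.mul_rpow_of_nonneg _ _ (by positivity),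
            rpow_rpow_of_mul (Vr r v c x) (c := 1) (by rw [hγ]; field_simp), ENNReal.rpow_one,
            rpow_rpow_of_mul (U x) (c := 1 / q) (by rw [hγ1]; field_simp),
            rpow_rpow_of_mul (W c) (c := -(1 / p)) (by rw [hθ, he]; field_simp),
            rpow_rpow_of_mul (S c) (c := (1 - r) / r) (by rw [hκ, he]; field_simp),
            Vr_of_lt_one hr1]
          calc _ = U x ^ (1 / q) * (W c ^ (-(1 / p)) * S c ^ ((1 - r) / r) * cκ ^ e) *
                (cγ ^ (-((1 - q) / q)) * cγ ^ ((1 - q) / q)) := by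
                rw [rpow_mul_rpow_of_add hcγ0 hcγt (neg_add_cancel _), ENNReal.rpow_zero, mul_one]
            _ = _ := by ring
      _ ≤ _ := mul_le_mul_right hC2 _
  have hsecond : U x ^ (1 / q) * (ENNReal.ofReal θ * cκ * B) ^ e ≤ K₂ * C₃ a b r p q u v w := by
    have hC3 : U x ^ (1 / q) * B ^ e ≤ C₃ a b r p q u v w := by
      refine le_trans ?_ (le_iSup₂_of_le x hx le_rfl)
      refine mul_le_mul_right (ENNReal.rpow_le_rpow ?_ hepos.le) _
      refine le_trans (lintegral_mono_set (Ioo_subset_Ioo_left hc.1.le)) (le_of_eq ?_)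
      refine lintegral_congr fun t => ?_
      rw [Vr_of_lt_one hr1, rpow_rpow_of_mul _ (c := κ) (by rw [hκ]; field_simp), hθ1,
        mul_comm (_ ^ (-1 - θ))]
    rw [ENNReal.mul_rpow_of_nonneg _ _ hepos.le]
    calc _ = K₂ * (U x ^ (1 / q) * B ^ e) := by ring
      _ ≤ _ := mul_le_mul_right hC3 _
  calc _ ≤ U x ^ (1 / q) * (W c ^ (-θ) * S c ^ κ * cκ + ENNReal.ofReal θ * cκ * B) ^ e :=
        mul_le_mul_right (ENNReal.rpow_le_rpow hsplit hepos.le) _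
    _ ≤ U x ^ (1 / q) * (2 ^ e * ((W c ^ (-θ) * S c ^ κ * cκ) ^ e +
          (ENNReal.ofReal θ * cκ * B) ^ e)) :=
        mul_le_mul_right (add_rpow_le_two_rpow_mul _ _ hepos.le) _
    _ = 2 ^ e * (U x ^ (1 / q) * (W c ^ (-θ) * S c ^ κ * cκ) ^ e +
          U x ^ (1 / q) * (ENNReal.ofReal θ * cκ * B) ^ e) := by ring
    _ ≤ 2 ^ e * (K₁ * C₂ a b r p q u v w + K₂ * C₃ a b r p q u v w) :=
        mul_le_mul_right (add_le_add hfirst hsecond) _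
    _ ≤ 2 ^ e * ((K₁ + K₂) * C₂ a b r p q u v w + (K₁ + K₂) * C₃ a b r p q u v w) := by
        gcongr
        · exact le_self_add
        · exact le_add_self
    _ = _ := by ring

lemma tsum_rpow_le_rpow_tsum {ι : Type*} (a : ι → ℝ≥0∞) {s : ℝ} (hs : 1 ≤ s) :
    ∑' i, a i ^ s ≤ (∑' i, a i) ^ s := by
  have key : ∀ z : ℝ≥0∞, z ^ s = z * z ^ (s - 1) := fun z => by
    nth_rewrite 2 [← ENNReal.rpow_one z]
    rw [← ENNReal.rpow_add_of_nonneg _ _ zero_le_one (by linarith)]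
    congr 1; ring
  calc ∑' i, a i ^ s ≤ ∑' i, a i * (∑' j, a j) ^ (s - 1) := by
        refine ENNReal.tsum_le_tsum fun i => ?_
        rw [key]
        exact mul_le_mul_right (ENNReal.rpow_le_rpow (ENNReal.le_tsum i) (by linarith)) _
    _ = _ := by rw [ENNReal.tsum_mul_right, ← key]

lemma sum_rpow_mul_rpow_le {ι : Type*} (s : Finset ι) (f g : ι → ℝ≥0∞) {a b : ℝ} (ha : 0 ≤ a)
    (hb : 0 ≤ b) (hab : a + b = 1) :
    ∑ i ∈ s, f i ^ a * g i ^ b ≤ (∑ i ∈ s, f i) ^ a * (∑ i ∈ s, g i) ^ b := by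
  let _ : MeasurableSpace s := ⊤
  have h := ENNReal.lintegral_mul_norm_pow_le (μ := Measure.count) (f := fun i : s => f i)
    (g := fun i : s => g i) (measurable_from_top.aemeasurable) (measurable_from_top.aemeasurable)
    ha hb hab
  simpa only [lintegral_count, tsum_fintype, Finset.univ_eq_attach,
    Finset.sum_attach s fun i => f i ^ a * g i ^ b, Finset.sum_attach s f,
    Finset.sum_attach s g] using h

lemma volume_Ioc_inter_le_sum {S : ℕ → ℝ} (L : Set ℝ) (k : ℕ) :
    volume (Ioc (S 0) (S k) ∩ L) ≤ ∑ j ∈ Finset.range k, volume (Ioc (S j) (S (j + 1)) ∩ L) := by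
  induction k with
  | zero => simp
  | succ k ih =>
    rw [Finset.sum_range_succ]
    calc _ ≤ volume ((Ioc (S 0) (S k) ∩ L) ∪ (Ioc (S k) (S (k + 1)) ∩ L)) := by
          rw [← union_inter_distrib_right]
          exact measure_mono (inter_subset_inter_left _ Ioc_subset_Ioc_union_Ioc)
      _ ≤ _ := (measure_union_le _ _).trans (add_le_add_left ih _)

lemma tsum_volume_inter_dyadic_le (J : Set ℝ) (hJ : MeasurableSet J) :
    ∑' n : ℤ, volume (J ∩ Ioc ((2 : ℝ) ^ n) (2 ^ (n + 1))) ≤ volume J := by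
  have hmono : Monotone fun n : ℤ => (2 : ℝ) ^ n := fun m n h =>
    zpow_le_zpow_right₀ one_le_two h
  rw [← measure_iUnion]
  · exact measure_mono (iUnion_subset fun n => inter_subset_left)
  · intro m n hmn
    exact (hmono.pairwise_disjoint_on_Ioc_succ hmn).mono inter_subset_right inter_subset_right
  · exact fun n => hJ.inter measurableSet_Ioc

lemma discrete_hardy {p q r : ℝ} (hr0 : 0 < r) (hrp : r < p) (hpq : p ≤ q)
    {s E α ℓ T : ℕ → ℝ≥0∞} {M : ℝ≥0∞} (hs : ∀ j, s j ≠ ∞)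
    (hsE : ∀ j, s j ≤ E j ^ (r / p) * α j ^ ((p - r) / p))
    (hT : ∀ k, T k ^ (1 / q) * (∑ j ∈ Finset.range k, α j) ^ ((p - r) / (p * r)) ≤ M)
    (hℓ : ∀ k, ∑' j, ℓ (j + k) ≤ T k) :
    ∑' k, ℓ k * (∑ j ∈ Finset.range k, s j) ^ (q / r) ≤
      4 ^ (q / r) * (M ^ q * (∑' j, E j) ^ (q / p)) := by
  have hp0 : 0 < p := by linarith
  have hq0 : 0 < q := by linarith
  have hpr : 0 < p - r := by linarith
  set Q := q / r with hQ
  have hQ0 : 0 < Q := by positivity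
  set S : ℕ → ℝ := fun k => ∑ j ∈ Finset.range k, (s j).toReal with hS
  have hSof : ∀ k, ENNReal.ofReal (S k) = ∑ j ∈ Finset.range k, s j := fun k => by
    rw [hS]; simp only
    rw [ENNReal.ofReal_sum_of_nonneg fun _ _ => ENNReal.toReal_nonneg]
    exact Finset.sum_congr rfl fun j _ => ENNReal.ofReal_toReal (hs j)
  have hS0 : S 0 = 0 := by simp [hS]
  have hSsucc : ∀ k, S (k + 1) - S k = (s k).toReal := fun k => by
    simp [hS, Finset.sum_range_succ]
  have hSmono : Monotone S := monotone_nat_of_le_succ fun k => by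
    have h1 := hSsucc k
    have h2 : 0 ≤ (s k).toReal := ENNReal.toReal_nonneg
    linarith
  set z : ℕ → ℤ → ℝ≥0∞ := fun j n =>
    volume (Ioc (S j) (S (j + 1)) ∩ Ioc ((2 : ℝ) ^ n) (2 ^ (n + 1))) with hz
  have hzs : ∀ j, ∑' n, z j n ≤ s j := fun j => by
    refine (tsum_volume_inter_dyadic_le _ measurableSet_Ioc).trans ?_
    rw [Real.volume_Ioc, hSsucc, ENNReal.ofReal_toReal (hs j)]
  set e : ℕ → ℝ≥0∞ := fun j => E j / s j with he
  set D : ℤ → ℝ≥0∞ := fun n => ∑' j, z j n * e j with hD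
  have hDsum : ∑' n, D n ≤ ∑' j, E j := by
    rw [hD, ENNReal.tsum_comm]
    refine ENNReal.tsum_le_tsum fun j => ?_
    rw [ENNReal.tsum_mul_right]
    exact (mul_le_mul_left (hzs j) _).trans ENNReal.mul_div_le
  have hzle : ∀ j n, z j n ≤ (z j n * e j) ^ (r / p) * α j ^ ((p - r) / p) := by
    intro j n
    have hle : z j n ≤ s j := (ENNReal.le_tsum n).trans (hzs j)
    rcases eq_or_ne (s j) 0 with h0 | h0
    · rw [h0] at hle
      exact hle.trans zero_le
    have hpow : ∀ y : ℝ≥0∞, y = y ^ (r / p) * y ^ ((p - r) / p) := fun y => by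
      rw [← ENNReal.rpow_add_of_nonneg _ _ (by positivity) (by positivity),
        show r / p + (p - r) / p = 1 by field_simp; ring, ENNReal.rpow_one]
    have h1 : s j ^ ((p - r) / p) ≤ e j ^ (r / p) * α j ^ ((p - r) / p) := by
      rw [he]; simp only
      rw [ENNReal.div_rpow_of_nonneg _ _ (by positivity), ENNReal.div_eq_inv_mul, mul_assoc,
        ← ENNReal.div_eq_inv_mul, ENNReal.le_div_iff_mul_le, mul_comm, ← hpow]
      · exact hsE j
      · left
        rw [Ne, ENNReal.rpow_eq_zero_iff_of_pos (by positivity)]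
        exact h0
      · left
        exact ENNReal.rpow_ne_top_of_nonneg (by positivity) (hs j)
    calc z j n = z j n ^ (r / p) * z j n ^ ((p - r) / p) := hpow _
      _ ≤ z j n ^ (r / p) * (e j ^ (r / p) * α j ^ ((p - r) / p)) := by
          refine mul_le_mul_right (le_trans (ENNReal.rpow_le_rpow hle (by positivity)) h1) _
      _ = _ := by rw [ENNReal.mul_rpow_of_nonneg _ _ (by positivity), mul_assoc]
  have hlevel : ∀ (n : ℤ) (k : ℕ), (2 : ℝ) ^ (n + 1) ≤ S k →
      ENNReal.ofReal ((2 : ℝ) ^ n) ^ Q * T k ≤ M ^ q * D n ^ (q / p) := by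
    intro n k hk
    have h2n : (0 : ℝ) < 2 ^ n := by positivity
    have h1 : ENNReal.ofReal ((2 : ℝ) ^ n) ≤ D n ^ (r / p) *
        (∑ j ∈ Finset.range k, α j) ^ ((p - r) / p) := by
      calc _ = volume (Ioc (S 0) (S k) ∩ Ioc ((2 : ℝ) ^ n) (2 ^ (n + 1))) := by
            rw [Ioc_inter_Ioc, hS0, sup_of_le_right h2n.le, inf_of_le_right hk, Real.volume_Ioc,
              zpow_add_one₀ two_ne_zero]
            congr 1; ring
        _ ≤ ∑ j ∈ Finset.range k, z j n := volume_Ioc_inter_le_sum _ k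
        _ ≤ ∑ j ∈ Finset.range k, (z j n * e j) ^ (r / p) * α j ^ ((p - r) / p) :=
            Finset.sum_le_sum fun j _ => hzle j n
        _ ≤ _ := sum_rpow_mul_rpow_le _ _ _ (by positivity) (by positivity) (by field_simp; ring)
        _ ≤ _ := by
            gcongr
            exact ENNReal.sum_le_tsum _
    calc _ ≤ (D n ^ (r / p) * (∑ j ∈ Finset.range k, α j) ^ ((p - r) / p)) ^ Q * T k := by
          gcongr
      _ = D n ^ (q / p) *
            (T k ^ (1 / q) * (∑ j ∈ Finset.range k, α j) ^ ((p - r) / (p * r))) ^ q := by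
          rw [ENNReal.mul_rpow_of_nonneg _ _ hQ0.le, ENNReal.mul_rpow_of_nonneg _ _ hq0.le,
            rpow_rpow_of_mul (D n) (c := q / p) (by rw [hQ]; field_simp),
            rpow_rpow_of_mul (T k) (c := 1) (by field_simp), ENNReal.rpow_one,
            rpow_rpow_of_mul _ (c := (p - r) * q / (p * r)) (by rw [hQ]; field_simp),
            rpow_rpow_of_mul _ (a := (p - r) / (p * r)) (c := (p - r) * q / (p * r))
              (by field_simp)]
          ring
      _ ≤ D n ^ (q / p) * M ^ q := mul_le_mul_right (ENNReal.rpow_le_rpow (hT k) hq0.le) _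
      _ = _ := mul_comm _ _
  set χ : ℕ → ℤ → ℝ≥0∞ := fun k n => if (2 : ℝ) ^ (n + 1) ≤ S k then 1 else 0 with hχ
  have hpt : ∀ k, ENNReal.ofReal (S k) ^ Q ≤
      4 ^ Q * ∑' n : ℤ, ENNReal.ofReal ((2 : ℝ) ^ n) ^ Q * χ k n := by
    intro k
    have hSk : 0 ≤ S k := hS0 ▸ hSmono (Nat.zero_le k)
    rcases hSk.eq_or_lt with h0 | h0
    · rw [← h0, ENNReal.ofReal_zero, ENNReal.zero_rpow_of_pos hQ0]
      exact zero_le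
    obtain ⟨m, hm1, hm2⟩ := exists_mem_Ico_zpow h0 one_lt_two
    have hχm : χ k (m - 1) = 1 := by
      rw [hχ]; simp only [sub_add_cancel, hm1, if_true]
    calc _ ≤ ENNReal.ofReal (4 * 2 ^ (m - 1)) ^ Q := by
          refine ENNReal.rpow_le_rpow (ENNReal.ofReal_le_ofReal (hm2.le.trans (le_of_eq ?_))) hQ0.le
          rw [show m + 1 = (m - 1) + 1 + 1 by ring, zpow_add_one₀ two_ne_zero,
            zpow_add_one₀ two_ne_zero]
          ring
      _ = 4 ^ Q * (ENNReal.ofReal ((2 : ℝ) ^ (m - 1)) ^ Q * χ k (m - 1)) := by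
          rw [ENNReal.ofReal_mul (by norm_num), ENNReal.mul_rpow_of_nonneg _ _ hQ0.le, hχm, mul_one]
          norm_num
      _ ≤ _ := mul_le_mul_right (ENNReal.le_tsum (m - 1)) _
  have hsumn : ∀ n : ℤ, ENNReal.ofReal ((2 : ℝ) ^ n) ^ Q * ∑' k, ℓ k * χ k n ≤
      M ^ q * D n ^ (q / p) := by
    intro n
    by_cases hex : ∃ k, (2 : ℝ) ^ (n + 1) ≤ S k
    · classical
      set N := Nat.find hex with hN
      have hN1 : (2 : ℝ) ^ (n + 1) ≤ S N := Nat.find_spec hex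
      refine le_trans (mul_le_mul_right ?_ _) (hlevel n N hN1)
      refine le_trans ?_ (hℓ N)
      rw [← ENNReal.summable.sum_add_tsum_nat_add' (f := fun k => ℓ k * χ k n) (k := N)]
      rw [Finset.sum_eq_zero, zero_add]
      · refine ENNReal.tsum_le_tsum fun j => ?_
        rw [hχ]
        exact mul_le_of_le_one_right zero_le (by beta_reduce; split_ifs <;> simp)
      · intro k hk
        have : ¬ (2 : ℝ) ^ (n + 1) ≤ S k := Nat.find_min hex (Finset.mem_range.1 hk)
        rw [hχ]; simp only [this, if_false, mul_zero]
    · have : ∑' k, ℓ k * χ k n = 0 := by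
        rw [ENNReal.tsum_eq_zero]
        intro k
        have : ¬ (2 : ℝ) ^ (n + 1) ≤ S k := fun h => hex ⟨k, h⟩
        rw [hχ]; simp only [this, if_false, mul_zero]
      rw [this, mul_zero]
      exact zero_le
  calc _ = ∑' k, ℓ k * ENNReal.ofReal (S k) ^ Q := by simp only [hSof]
    _ ≤ ∑' k, ℓ k * (4 ^ Q * ∑' n : ℤ, ENNReal.ofReal ((2 : ℝ) ^ n) ^ Q * χ k n) :=
        ENNReal.tsum_le_tsum fun k => mul_le_mul_right (hpt k) _
    _ = 4 ^ Q * ∑' n : ℤ, ENNReal.ofReal ((2 : ℝ) ^ n) ^ Q * ∑' k, ℓ k * χ k n := by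
        simp only [← ENNReal.tsum_mul_left]
        rw [ENNReal.tsum_comm]
        refine tsum_congr fun n => tsum_congr fun k => ?_
        ring
    _ ≤ 4 ^ Q * ∑' n, M ^ q * D n ^ (q / p) :=
        mul_le_mul_right (ENNReal.tsum_le_tsum hsumn) _
    _ ≤ _ := by
        rw [ENNReal.tsum_mul_left]
        refine mul_le_mul_right (mul_le_mul_right ?_ _) _
        refine (tsum_rpow_le_rpow_tsum _ (by rwa [le_div_iff₀ hp0, one_mul])).trans ?_
        exact ENNReal.rpow_le_rpow hDsum (by positivity)

lemma setLIntegral_Ioo_add (g : ℝ → ℝ≥0∞) {x y z : ℝ} (hxy : x ≤ y) (hyz : y ≤ z) :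
    ∫⁻ s in Ioo x z, g s = (∫⁻ s in Ioo x y, g s) + ∫⁻ s in Ioo y z, g s := by
  rw [setLIntegral_congr (Ioo_ae_eq_Ioc (a := x) (b := z)),
    setLIntegral_congr (Ioo_ae_eq_Ioc (a := x) (b := y)),
    setLIntegral_congr (Ioo_ae_eq_Ioc (a := y) (b := z)), ← Ioc_union_Ioc_eq_Ioc hxy hyz,
    lintegral_union measurableSet_Ioc (Ioc_disjoint_Ioc_of_le le_rfl)]

lemma setLIntegral_Ioo_eq_sum (g : ℝ → ℝ≥0∞) {x : ℕ → ℝ} (hx : Monotone x) (k : ℕ) :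
    ∫⁻ s in Ioo (x 0) (x k), g s = ∑ j ∈ Finset.range k, ∫⁻ s in Ioo (x j) (x (j + 1)), g s := by
  induction k with
  | zero => simp
  | succ k ih =>
    rw [Finset.sum_range_succ, ← ih]
    exact setLIntegral_Ioo_add g (hx (Nat.zero_le k)) (hx (Nat.le_succ k))

lemma tsum_setLIntegral_Ioo_le (g : ℝ → ℝ≥0∞) {x : ℕ → ℝ} (hx : Monotone x) {b : ℝ}
    (hb : ∀ n, x n ≤ b) (k : ℕ) :
    ∑' j, ∫⁻ s in Ioo (x (j + k)) (x (j + k + 1)), g s ≤ ∫⁻ s in Ioo (x k) b, g s := by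
  refine ENNReal.tsum_le_of_sum_range_le fun n => ?_
  have h := setLIntegral_Ioo_eq_sum g (x := fun j => x (j + k)) (fun i j hij => hx (by omega)) n
  simp only [zero_add] at h
  calc _ = ∑ j ∈ Finset.range n, ∫⁻ s in Ioo (x (j + k)) (x (j + 1 + k)), g s := by
        refine Finset.sum_congr rfl fun j _ => ?_
        rw [add_right_comm]
    _ = _ := h.symm
    _ ≤ _ := lintegral_mono_set (Ioo_subset_Ioo_right (hb _))

lemma setLIntegral_Ioo_le_tsum (g : ℝ → ℝ≥0∞) {x : ℕ → ℝ} {b : ℝ}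
    (hb : ∀ t ∈ Ico (x 0) b, ∃ n, t < x n) :
    ∫⁻ s in Ioo (x 0) b, g s ≤ ∑' j, ∫⁻ s in Ioo (x j) (x (j + 1)), g s := by
  have hsub : Ioo (x 0) b ⊆ ⋃ j, Ico (x j) (x (j + 1)) := by
    intro t ht
    classical
    have hex := hb t ⟨ht.1.le, ht.2⟩
    have h1 := Nat.find_spec hex
    have h0 : Nat.find hex ≠ 0 := fun h => by
      rw [h] at h1
      exact lt_asymm h1 ht.1
    obtain ⟨m, hm⟩ := Nat.exists_eq_succ_of_ne_zero h0
    refine mem_iUnion.2 ⟨m, not_lt.1 (Nat.find_min hex (m := m) (by omega)), ?_⟩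
    rwa [hm] at h1
  calc _ ≤ ∫⁻ s in ⋃ j, Ico (x j) (x (j + 1)), g s := lintegral_mono_set hsub
    _ ≤ ∑' j, ∫⁻ s in Ico (x j) (x (j + 1)), g s := lintegral_iUnion_le _ _
    _ = _ := by simp only [setLIntegral_congr Ioo_ae_eq_Ico]

lemma exists_dyadic_partition {w : ℝ → ℝ≥0∞} {c b : ℝ} (hcb : c < b)
    (h0 : ∀ t ∈ Ico c b, ∫⁻ s in Ioo t b, w s ≠ 0) (hfin : ∫⁻ s in Ioo c b, w s ≠ ∞) :
    ∃ x : ℕ → ℝ, x 0 = c ∧ Monotone x ∧ (∀ n, x n ∈ Ico c b) ∧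
      (∀ n, ∫⁻ s in Ioo (x n) b, w s = 2 * ∫⁻ s in Ioo (x (n + 1)) b, w s) ∧
      ∀ t ∈ Ico c b, ∃ n, t < x n := by
  set μ := (volume.restrict (Ioo c b)).withDensity w with hμ
  have hμ' : ∀ s, MeasurableSet s → μ s = ∫⁻ y in s ∩ Ioo c b, w y := fun s hs => by
    rw [hμ, withDensity_apply _ hs, Measure.restrict_restrict hs]
  have hμuniv : μ univ = ∫⁻ y in Ioo c b, w y := by rw [hμ' _ MeasurableSet.univ, univ_inter]
  have : IsFiniteMeasure μ := ⟨by rw [hμuniv]; exact hfin.lt_top⟩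
  have hna : NullSingletonClass μ := noAtoms_withDensity_restrict w (Ioo c b)
  set h : ℝ → ℝ := fun t => μ.real (Iio t) with hh
  set m := μ.real univ with hm
  have hcont : Continuous h := continuous_measureReal_Iio μ
  have hmono : Monotone h := fun s t hst => measureReal_mono (Iio_subset_Iio hst)
  have hfin' : ∀ t, c ≤ t → ∫⁻ s in Ioo t b, w s ≠ ∞ := fun t ht =>
    ne_top_of_le_ne_top hfin (lintegral_mono_set (Ioo_subset_Ioo_left ht))
  have htail : ∀ t, c ≤ t → (∫⁻ s in Ioo t b, w s).toReal = m - h t := by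
    intro t ht
    have h1 : ∫⁻ s in Ioo t b, w s = μ (Iio t)ᶜ := by
      rw [compl_Iio, ← measure_congr Ioi_ae_eq_Ici, hμ' _ measurableSet_Ioi]
      congr 2
      ext s
      simp only [mem_inter_iff, mem_Ioi, mem_Ioo]
      exact ⟨fun hs => ⟨hs.1, ht.trans_lt hs.1, hs.2⟩, fun hs => ⟨hs.1, hs.2.2⟩⟩
    rw [h1, hm, ← measureReal_add_measureReal_compl (μ := μ) (measurableSet_Iio (a := t)), hh,
      add_sub_cancel_left]
    rfl
  have hpos : ∀ t ∈ Ico c b, 0 < m - h t := fun t ht => by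
    rw [← htail t ht.1]
    exact ENNReal.toReal_pos (h0 t ht) (hfin' t ht.1)
  have hc0 : h c = 0 := by
    rw [hh]; simp only
    rw [measureReal_def, hμ' _ measurableSet_Iio,
      show Iio c ∩ Ioo c b = ∅ by
        ext s
        simp only [mem_inter_iff, mem_Iio, mem_Ioo, mem_empty_iff_false, iff_false]
        exact fun hs => lt_asymm hs.1 hs.2.1]
    simp
  have hb : h b = m := by
    have h1 := htail b hcb.le
    rw [Ioo_self, Measure.restrict_empty, lintegral_zero_measure, ENNReal.toReal_zero] at h1
    linarith
  have hm0 : 0 < m := by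
    have h1 := hpos c ⟨le_rfl, hcb⟩
    rwa [hc0, sub_zero] at h1
  have hex : ∀ n : ℕ, ∃ y ∈ Icc c b, h y = m * (1 - (1 / 2) ^ n) ∧ (n = 0 → y = c) := by
    intro n
    rcases Nat.eq_zero_or_pos n with rfl | hn
    · exact ⟨c, ⟨le_rfl, hcb.le⟩, by simp [hc0], fun _ => rfl⟩
    have h1 : (1 / 2 : ℝ) ^ n ≤ 1 := pow_le_one₀ (by norm_num) (by norm_num)
    have h2 : (0 : ℝ) < (1 / 2) ^ n := by positivity
    obtain ⟨y, hy, hy'⟩ := intermediate_value_Icc hcb.le hcont.continuousOn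
      (show m * (1 - (1 / 2) ^ n) ∈ Icc (h c) (h b) by
        rw [hc0, hb]
        constructor <;> nlinarith)
    exact ⟨y, hy, hy', fun h => absurd h hn.ne'⟩
  choose x hxm hxh hx0 using hex
  have hxlt : ∀ n, x n < b := fun n => by
    refine lt_of_le_of_ne (hxm n).2 fun heq => ?_
    have h1 := hxh n
    rw [heq, hb] at h1
    have h2 : (0 : ℝ) < (1 / 2) ^ n := by positivity
    nlinarith
  refine ⟨x, hx0 0 rfl, monotone_nat_of_le_succ fun n => ?_, fun n => ⟨(hxm n).1, hxlt n⟩,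
    fun n => ?_, fun t ht => ?_⟩
  · by_contra! hlt
    have h1 := hmono hlt.le
    rw [hxh, hxh, pow_succ] at h1
    have h2 : (0 : ℝ) < (1 / 2) ^ n := by positivity
    nlinarith
  · have hne := hfin' _ (hxm n).1
    have hne' := hfin' _ (hxm (n + 1)).1
    rw [← ENNReal.toReal_eq_toReal_iff' hne (by finiteness), ENNReal.toReal_mul, htail _ (hxm n).1,
      htail _ (hxm (n + 1)).1, hxh, hxh, pow_succ, ENNReal.toReal_ofNat]
    ring
  · have h1 := hpos t ht
    obtain ⟨n, hn⟩ := exists_pow_lt_of_lt_one (div_pos h1 hm0) (by norm_num : (1 / 2 : ℝ) < 1)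
    refine ⟨n, ?_⟩
    by_contra! hle
    have h2 := hmono hle
    rw [hxh] at h2
    rw [lt_div_iff₀ hm0] at hn
    nlinarith

lemma setLIntegral_rpow_mul_le {f v : ℝ → ℝ≥0∞} (hf : Measurable f) (hv : Measurable v) {r : ℝ}
    (hr0 : 0 < r) (hr1 : r < 1) (s : Set ℝ) :
    ∫⁻ t in s, f t ^ r * v t ≤
      (∫⁻ t in s, f t) ^ r * (∫⁻ t in s, v t ^ (1 / (1 - r))) ^ (1 - r) := by
  have hr1' : 0 < 1 - r := by linarith
  refine le_trans (le_of_eq ?_) (ENNReal.lintegral_mul_norm_pow_le (μ := volume.restrict s)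
    (f := f) (g := fun t => v t ^ (1 / (1 - r))) hf.aemeasurable (by fun_prop) hr0.le hr1'.le
    (by ring))
  refine lintegral_congr fun t => ?_
  rw [rpow_rpow_of_mul (v t) (c := 1) (by field_simp), ENNReal.rpow_one]

lemma tsum_tail_mul_rpow_le {b p : ℝ} (hp : 0 < p) {f w : ℝ → ℝ≥0∞} {x : ℕ → ℝ} (hx : Monotone x)
    (hxb : ∀ n, x n ≤ b) (hfin : ∫⁻ t in Ioo (x 0) b, w t ≠ ∞)
    (hw : ∀ n, ∫⁻ t in Ioo (x n) b, w t = 2 * ∫⁻ t in Ioo (x (n + 1)) b, w t) :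
    ∑' j, (∫⁻ t in Ioo (x j) b, w t) * (∫⁻ t in Ioo (x j) (x (j + 1)), f t) ^ p ≤
      4 * ∫⁻ t in Ioo (x 0) b, (∫⁻ s in Ioo (x 0) t, f s) ^ p * w t := by
  have hblock : ∀ j, (∫⁻ t in Ioo (x j) b, w t) =
      4 * ∫⁻ t in Ioo (x (j + 1)) (x (j + 2)), w t := by
    intro j
    have h1 := hw (j + 1)
    have hne : ∫⁻ t in Ioo (x (j + 2)) b, w t ≠ ∞ :=
      ne_top_of_le_ne_top hfin (lintegral_mono_set (Ioo_subset_Ioo_left (hx (Nat.zero_le _))))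
    have h2 := setLIntegral_Ioo_add w (hx (Nat.le_succ (j + 1))) (hxb (j + 2))
    rw [h2, two_mul, ENNReal.add_left_inj hne] at h1
    rw [hw j, hw (j + 1), h1, ← mul_assoc]
    norm_num
  calc _ ≤ ∑' j, 4 * ∫⁻ t in Ioo (x (j + 1)) (x (j + 1 + 1)),
          (∫⁻ s in Ioo (x 0) t, f s) ^ p * w t := by
        refine ENNReal.tsum_le_tsum fun j => ?_
        rw [hblock, mul_assoc, mul_comm (∫⁻ t in Ioo (x (j + 1)) (x (j + 2)), w t)]
        refine mul_le_mul_right ?_ _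
        refine (lintegral_const_mul_le _ _).trans ?_
        refine setLIntegral_mono' measurableSet_Ioo fun t ht => ?_
        refine mul_le_mul_left (ENNReal.rpow_le_rpow ?_ hp.le) _
        exact lintegral_mono_set (Ioo_subset_Ioo (hx (Nat.zero_le _)) ht.1.le)
    _ ≤ _ := by
        rw [ENNReal.tsum_mul_left]
        refine mul_le_mul_right ?_ _
        exact (tsum_setLIntegral_Ioo_le _ hx hxb 1).trans
          (lintegral_mono_set (Ioo_subset_Ioo_left (hx (Nat.zero_le _))))

lemma left_local_bound_exists (p q r : ℝ) (hr0 : 0 < r) (hrp : r < p) (hpq : p ≤ q) (hq1 : q < 1) :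
    ∃ K : ℝ≥0∞, K ≠ ∞ ∧ ∀ (a b : ℝ) (u v w f : ℝ → ℝ≥0∞), Measurable u →
      Measurable v → Measurable f → (∫⁻ s in Ioo a b, u s ≠ ∞) →
      (∫⁻ s in Ioo a b, v s ^ (1 / (1 - r)) ≠ ∞) →
      ∀ x ∈ Ioo a b, ∀ d ≤ b, (∫⁻ s in Ioo x b, w s ≠ 0) → (∫⁻ s in Ioo x b, w s ≠ ∞) →
      (∫⁻ s in Ioo x d, f s ^ r * v s ≠ ∞) →
      (∀ t ∈ Ioo x d, ∫⁻ s in Ioo x t, v s ^ (1 / (1 - r)) ≠ 0) →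
      ∫⁻ t in Ioo x d, u t * (∫⁻ s in Ioo x t, f s ^ r * v s) ^ (q / r) ≤
        K * (C₂ a b r p q u v w ^ q *
          ((∫⁻ t in Ioo x b, w t) * (∫⁻ t in Ioo x d, f t) ^ p) ^ (q / p)) := by
  have hr1 : r < 1 := by linarith
  have hq1' : 0 < 1 - q := by linarith
  have hq0 : 0 < q := by linarith
  have hp0 : 0 < p := by linarith
  obtain ⟨K, hK, hmaz⟩ := mazya_exists r q hr0 (by linarith) hq1
  refine ⟨K, hK, fun a b u v w f hu hv hf hufin hσfin x hx d hd hw0 hwt hffin hσ0 => ?_⟩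
  have hsub : Ioo x d ⊆ Ioo a b := Ioo_subset_Ioo hx.1.le hd
  refine (hmaz x d u v f hu hv hf (ne_top_of_le_ne_top hσfin (lintegral_mono_set hsub))
    (ne_top_of_le_ne_top hufin (lintegral_mono_set hsub)) hffin hσ0).trans ?_
  refine mul_le_mul_right ?_ _
  set A := ∫⁻ t in Ioo x b,
    (∫⁻ s in Ioo t b, u s) ^ (q / (1 - q)) * u t * Vr r v x t ^ (q / (1 - q)) with hA
  have h1 : (∫⁻ t in Ioo x d, (u t * (∫⁻ s in Ioo t d, u s) ^ (q / (1 - q))) *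
        (∫⁻ s in Ioo x t, v s ^ (1 / (1 - r))) ^ (q * (1 - r) / (r * (1 - q)))) ≤ A := by
    refine le_trans ?_ (lintegral_mono_set (Ioo_subset_Ioo_right hd))
    refine setLIntegral_mono' measurableSet_Ioo fun t ht => ?_
    rw [Vr_of_lt_one hr1, rpow_rpow_of_mul _ (c := q * (1 - r) / (r * (1 - q)))
      (by field_simp), mul_comm (_ ^ _) (u t)]
    gcongr
  have h2 : A ^ (1 - q) ≤ C₂ a b r p q u v w ^ q * (∫⁻ t in Ioo x b, w t) ^ (q / p) := by
    have h3 : (∫⁻ t in Ioo x b, w t) ^ (-(1 / p)) * A ^ ((1 - q) / q) ≤ C₂ a b r p q u v w :=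
      le_iSup₂_of_le x hx le_rfl
    have h4 := ENNReal.rpow_le_rpow h3 hq0.le
    rw [ENNReal.mul_rpow_of_nonneg _ _ hq0.le, rpow_rpow_of_mul A (c := 1 - q) (by field_simp),
      rpow_rpow_of_mul _ (c := -(q / p)) (by field_simp)] at h4
    calc A ^ (1 - q) = ((∫⁻ t in Ioo x b, w t) ^ (-(q / p)) * A ^ (1 - q)) *
          (∫⁻ t in Ioo x b, w t) ^ (q / p) := by
          rw [mul_right_comm, rpow_mul_rpow_of_add hw0 hwt (neg_add_cancel _), ENNReal.rpow_zero,
            one_mul]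
      _ ≤ _ := mul_le_mul_left h4 _
  calc _ ≤ A ^ (1 - q) * (∫⁻ t in Ioo x d, f t) ^ q :=
        mul_le_mul_left (ENNReal.rpow_le_rpow h1 hq1'.le) _
    _ ≤ C₂ a b r p q u v w ^ q * (∫⁻ t in Ioo x b, w t) ^ (q / p) *
          (∫⁻ t in Ioo x d, f t) ^ q := mul_le_mul_left h2 _
    _ = _ := by
        rw [ENNReal.mul_rpow_of_nonneg _ _ (by positivity),
          rpow_rpow_of_mul _ (c := q) (by field_simp), mul_assoc]

lemma sum_tail_rpow_mul_le {a b θ κ : ℝ} (hθ : 0 ≤ θ) (hκ : 1 ≤ κ) {w σ : ℝ → ℝ≥0∞}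
    (hσ : Measurable σ) (hσfin : ∫⁻ s in Ioo a b, σ s ≠ ∞) {x : ℕ → ℝ} (hx : Monotone x)
    (hxa : a ≤ x 0) (hxb : ∀ n, x n ≤ b) (k : ℕ) :
    ∑ j ∈ Finset.range k, (∫⁻ t in Ioo (x j) b, w t) ^ (-θ) *
        (∫⁻ t in Ioo (x j) (x (j + 1)), σ t) ^ κ ≤
      ENNReal.ofReal κ * ∫⁻ s in Ioo (x 0) (x k), (∫⁻ t in Ioo s b, w t) ^ (-θ) *
        (σ s * (∫⁻ t in Ioo s (x k), σ t) ^ (κ - 1)) := by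
  rw [setLIntegral_Ioo_eq_sum _ hx, Finset.mul_sum]
  refine Finset.sum_le_sum fun j hj => ?_
  have hjk : x (j + 1) ≤ x k := hx (Finset.mem_range.1 hj)
  have hxj : a ≤ x j := hxa.trans (hx (Nat.zero_le _))
  have hfin : ∫⁻ s in Ioo (x j) (x (j + 1)), σ s ≠ ∞ :=
    ne_top_of_le_ne_top hσfin (lintegral_mono_set (Ioo_subset_Ioo hxj (hxb _)))
  have h := lintegral_tail_rpow hσ hfin (β := κ - 1) (by linarith)
  rw [sub_add_cancel] at h
  calc _ = ENNReal.ofReal κ * ((∫⁻ t in Ioo (x j) b, w t) ^ (-θ) *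
        ∫⁻ s in Ioo (x j) (x (j + 1)), σ s * (∫⁻ t in Ioo s (x (j + 1)), σ t) ^ (κ - 1)) := by
        have h1 := ofReal_inv_mul_cancel (x := κ) (by linarith)
        rw [h]
        calc _ = (∫⁻ t in Ioo (x j) b, w t) ^ (-θ) *
              (∫⁻ t in Ioo (x j) (x (j + 1)), σ t) ^ κ *
              (ENNReal.ofReal κ⁻¹ * ENNReal.ofReal κ) := by rw [h1, mul_one]
          _ = _ := by ring
    _ ≤ ENNReal.ofReal κ * ∫⁻ s in Ioo (x j) (x (j + 1)), (∫⁻ t in Ioo (x j) b, w t) ^ (-θ) *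
        (σ s * (∫⁻ t in Ioo s (x (j + 1)), σ t) ^ (κ - 1)) :=
        mul_le_mul_right (lintegral_const_mul_le _ _) _
    _ ≤ _ := by
        refine mul_le_mul_right (setLIntegral_mono' measurableSet_Ioo fun s hs => ?_) _
        refine mul_le_mul' (rpow_anti_of_nonpos (by linarith)
          (lintegral_mono_set (Ioo_subset_Ioo_left hs.1.le))) (mul_le_mul_right ?_ _)
        exact ENNReal.rpow_le_rpow (lintegral_mono_set (Ioo_subset_Ioo_right hjk)) (by linarith)

lemma sufficiency_truncated_exists (p q r : ℝ) (hr0 : 0 < r) (hrp : r < p) (hpq : p ≤ q)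
    (hq1 : q < 1) :
    ∃ K : ℝ≥0∞, K ≠ ∞ ∧ ∀ (a b : ℝ) (u v w f : ℝ → ℝ≥0∞), Measurable u →
      Measurable v → Measurable w → Measurable f → (∫⁻ s in Ioo a b, u s ≠ ∞) →
      (∫⁻ s in Ioo a b, v s ^ (1 / (1 - r)) ≠ ∞) →
      (∀ x ∈ Ioo a b, ∫⁻ s in Ioo x b, w s ≠ 0) → (∀ x ∈ Ioo a b, ∫⁻ s in Ioo x b, w s ≠ ∞) →
      (∀ x ∈ Ioo a b, ∀ t ∈ Ioo x b, ∫⁻ s in Ioo x t, v s ^ (1 / (1 - r)) ≠ 0) →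
      ∀ c ∈ Ioo a b, (∫⁻ s in Ioo c b, f s ^ r * v s ≠ ∞) →
      ∫⁻ t in Ioo c b, u t * (∫⁻ s in Ioo c t, f s ^ r * v s) ^ (q / r) ≤
        K * ((C₂ a b r p q u v w + C₃ a b r p q u v w) ^ q *
          (∫⁻ t in Ioo c b, (∫⁻ s in Ioo c t, f s) ^ p * w t) ^ (q / p)) := by
  have hr1 : r < 1 := by linarith
  have hq1' : 0 < 1 - q := by linarith
  have hr1' : 0 < 1 - r := by linarith
  have hq0 : 0 < q := by linarith
  have hp0 : 0 < p := by linarith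
  have hpr : 0 < p - r := by linarith
  have hκ : 1 ≤ p * (1 - r) / (p - r) := by
    rw [le_div_iff₀ hpr]
    nlinarith
  obtain ⟨K₁, hK₁, hright⟩ := right_bound_exists p q r hr0 hrp hpq hq1
  obtain ⟨K₂, hK₂, hleft⟩ := left_local_bound_exists p q r hr0 hrp hpq hq1
  set κ : ℝ := p * (1 - r) / (p - r) with hκdef
  set θ : ℝ := r / (p - r) with hθ
  set e : ℝ := (p - r) / (p * r) with he
  have he0 : 0 < e := by positivity
  set K₃ := ENNReal.ofReal κ ^ e * K₁ with hK₃
  refine ⟨2 ^ (q / r) * (4 ^ (q / r) * K₃ ^ q + K₂) * 4 ^ (q / p), by finiteness,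
    fun a b u v w f hu hv hw hf hufin hσfin hw0 hwt hσ0 c hc hg => ?_⟩
  set D := C₂ a b r p q u v w + C₃ a b r p q u v w with hD
  obtain ⟨x, hx0, hx, hxm, hxw, hxc⟩ := exists_dyadic_partition hc.2
    (fun t ht => hw0 t ⟨hc.1.trans_le ht.1, ht.2⟩) (hwt c hc)
  have hxb : ∀ n, x n ≤ b := fun n => (hxm n).2.le
  have hxab : ∀ n, x n ∈ Ioo a b := fun n => ⟨hc.1.trans_le (hxm n).1, (hxm n).2⟩
  set g : ℝ → ℝ≥0∞ := fun s => f s ^ r * v s with hgdef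
  set W : ℝ → ℝ≥0∞ := fun t => ∫⁻ s in Ioo t b, w s with hW
  set E : ℕ → ℝ≥0∞ := fun j => W (x j) * (∫⁻ t in Ioo (x j) (x (j + 1)), f t) ^ p with hE
  set s : ℕ → ℝ≥0∞ := fun j => ∫⁻ t in Ioo (x j) (x (j + 1)), g t with hs
  set ℓ : ℕ → ℝ≥0∞ := fun j => ∫⁻ t in Ioo (x j) (x (j + 1)), u t with hℓ
  set α : ℕ → ℝ≥0∞ := fun j => W (x j) ^ (-θ) *
    (∫⁻ t in Ioo (x j) (x (j + 1)), v t ^ (1 / (1 - r))) ^ κ with hα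
  have hgfin : ∀ j, s j ≠ ∞ := fun j =>
    ne_top_of_le_ne_top hg (lintegral_mono_set (Ioo_subset_Ioo (hxm j).1 (hxb _)))
  have hEF : ∑' j, E j ≤ 4 * ∫⁻ t in Ioo c b, (∫⁻ s in Ioo c t, f s) ^ p * w t := by
    have h := tsum_tail_mul_rpow_le hp0 (f := f) hx hxb (by rw [hx0]; exact hwt c hc) hxw
    rwa [hx0] at h
  have hglobal : ∑' k, ℓ k * (∑ j ∈ Finset.range k, s j) ^ (q / r) ≤
      4 ^ (q / r) * ((K₃ * D) ^ q * (∑' j, E j) ^ (q / p)) := by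
    refine discrete_hardy (α := α) (T := fun k => ∫⁻ t in Ioo (x k) b, u t) hr0 hrp hpq hgfin
      (fun j => ?_) (fun k => ?_) (fun k => ?_)
    · refine (setLIntegral_rpow_mul_le hf hv hr0 hr1 _).trans (le_of_eq ?_)
      rw [hE, hα]
      beta_reduce
      rw [ENNReal.mul_rpow_of_nonneg _ _ (by positivity),
        ENNReal.mul_rpow_of_nonneg _ _ (by positivity),
        rpow_rpow_of_mul (W (x j)) (c := -(r / p)) (by rw [hθ]; field_simp),
        rpow_rpow_of_mul (∫⁻ t in Ioo (x j) (x (j + 1)), f t) (c := r) (by field_simp),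
        rpow_rpow_of_mul _ (a := κ) (c := 1 - r) (by rw [hκdef]; field_simp)]
      generalize (∫⁻ t in Ioo (x j) (x (j + 1)), v t ^ (1 / (1 - r))) ^ (1 - r) = z
      calc _ = (W (x j) ^ (r / p) * W (x j) ^ (-(r / p))) *
            ((∫⁻ t in Ioo (x j) (x (j + 1)), f t) ^ r * z) := by
            rw [rpow_mul_rpow_of_add (hw0 _ (hxab j)) (hwt _ (hxab j)) (add_neg_cancel _),
              ENNReal.rpow_zero, one_mul]
        _ = _ := by ring
    · have h1 := sum_tail_rpow_mul_le (w := w) (θ := θ) (σ := fun t => v t ^ (1 / (1 - r)))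
        (by positivity) hκ (by fun_prop) hσfin hx (hxab 0).1.le hxb k
      have h2 := hright a b u v w hu hv hw hufin hσfin hw0 hwt c hc (x k) (hxab k) (hxm k).1
      rw [hx0] at h1
      calc _ ≤ (∫⁻ t in Ioo (x k) b, u t) ^ (1 / q) * (ENNReal.ofReal κ *
            ∫⁻ s in Ioo c (x k), (∫⁻ t in Ioo s b, w t) ^ (-θ) * (v s ^ (1 / (1 - r)) *
              (∫⁻ t in Ioo s (x k), v t ^ (1 / (1 - r))) ^ (κ - 1))) ^ e :=
            mul_le_mul_right (ENNReal.rpow_le_rpow h1 he0.le) _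
        _ ≤ ENNReal.ofReal κ ^ e * (K₁ * D) := by
            rw [ENNReal.mul_rpow_of_nonneg _ _ he0.le, mul_left_comm]
            exact mul_le_mul_right h2 _
        _ = _ := (mul_assoc _ _ _).symm
    · exact tsum_setLIntegral_Ioo_le u hx hxb k
  have hlocal : ∑' k, ∫⁻ t in Ioo (x k) (x (k + 1)), u t * (∫⁻ s in Ioo (x k) t, g s) ^ (q / r) ≤
      K₂ * (D ^ q * (∑' j, E j) ^ (q / p)) := by
    calc _ ≤ ∑' k, K₂ * (D ^ q * E k ^ (q / p)) := by
          refine ENNReal.tsum_le_tsum fun k => ?_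
          refine (hleft a b u v w f hu hv hf hufin hσfin (x k) (hxab k) (x (k + 1)) (hxb _)
            (hw0 _ (hxab k)) (hwt _ (hxab k)) (hgfin k) fun t ht => ?_).trans ?_
          · exact hσ0 _ (hxab k) t ⟨ht.1, ht.2.trans_le (hxb _)⟩
          · gcongr
            exact le_self_add
      _ ≤ _ := by
          rw [ENNReal.tsum_mul_left, ENNReal.tsum_mul_left]
          gcongr
          exact tsum_rpow_le_rpow_tsum _ ((one_le_div₀ hp0).2 hpq)
  calc _ ≤ ∑' k, ∫⁻ t in Ioo (x k) (x (k + 1)), u t * (∫⁻ s in Ioo c t, g s) ^ (q / r) := by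
        have h := setLIntegral_Ioo_le_tsum (x := x) (b := b)
          (fun t => u t * (∫⁻ s in Ioo c t, g s) ^ (q / r)) (by rwa [hx0])
        rwa [hx0] at h
    _ ≤ ∑' k, 2 ^ (q / r) * (ℓ k * (∑ j ∈ Finset.range k, s j) ^ (q / r) +
          ∫⁻ t in Ioo (x k) (x (k + 1)), u t * (∫⁻ s in Ioo (x k) t, g s) ^ (q / r)) := by
        refine ENNReal.tsum_le_tsum fun k => ?_
        have hm : Measurable fun t => ∫⁻ s in Ioo (x k) t, g s := measurable_primitive _ _
        rw [hℓ, ← lintegral_mul_const _ hu, ← lintegral_add_left (by fun_prop),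
          ← lintegral_const_mul _ (by fun_prop)]
        refine setLIntegral_mono' measurableSet_Ioo fun t ht => ?_
        have h1 : ∫⁻ s in Ioo c t, g s =
            ∑ j ∈ Finset.range k, s j + ∫⁻ s in Ioo (x k) t, g s := by
          rw [setLIntegral_Ioo_add g (hxm k).1 ht.1.le, hs, ← setLIntegral_Ioo_eq_sum g hx, hx0]
        rw [h1]
        calc _ ≤ u t * (2 ^ (q / r) * ((∑ j ∈ Finset.range k, s j) ^ (q / r) +
              (∫⁻ s in Ioo (x k) t, g s) ^ (q / r))) :=
              mul_le_mul_right (add_rpow_le_two_rpow_mul _ _ (by positivity)) _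
          _ = _ := by ring
    _ ≤ 2 ^ (q / r) * (4 ^ (q / r) * ((K₃ * D) ^ q * (∑' j, E j) ^ (q / p)) +
          K₂ * (D ^ q * (∑' j, E j) ^ (q / p))) := by
        rw [ENNReal.tsum_mul_left, ENNReal.tsum_add]
        exact mul_le_mul_right (add_le_add hglobal hlocal) _
    _ = 2 ^ (q / r) * (4 ^ (q / r) * K₃ ^ q + K₂) * (D ^ q * (∑' j, E j) ^ (q / p)) := by
        rw [ENNReal.mul_rpow_of_nonneg _ _ hq0.le]
        ring
    _ ≤ 2 ^ (q / r) * (4 ^ (q / r) * K₃ ^ q + K₂) * (D ^ q *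
          (4 * ∫⁻ t in Ioo c b, (∫⁻ s in Ioo c t, f s) ^ p * w t) ^ (q / p)) := by
        gcongr
    _ = _ := by
        rw [ENNReal.mul_rpow_of_nonneg 4 _ (z := q / p) (by positivity)]
        ring

/-- The sequence `f` is nondecreasing with supremum `l`. -/
def IncreasesTo (f : ℕ → ℝ≥0∞) (l : ℝ≥0∞) : Prop := Monotone f ∧ ⨆ n, f n = l

namespace IncreasesTo

lemma le_of_forall_le {f : ℕ → ℝ≥0∞} {l K : ℝ≥0∞} (hf : IncreasesTo f l) (h : ∀ n, f n ≤ K) :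
    l ≤ K := hf.2 ▸ iSup_le h

lemma const (l : ℝ≥0∞) : IncreasesTo (fun _ => l) l := ⟨monotone_const, iSup_const⟩

lemma mul {f g : ℕ → ℝ≥0∞} {l m : ℝ≥0∞} (hf : IncreasesTo f l) (hg : IncreasesTo g m) :
    IncreasesTo (fun n => f n * g n) (l * m) := by
  refine ⟨hf.1.mul' hg.1, ?_⟩
  rw [← hf.2, ← hg.2]
  refine le_antisymm (iSup_le fun n => mul_le_mul' (le_iSup f n) (le_iSup g n)) ?_
  rw [ENNReal.mul_iSup]
  refine iSup_le fun j => ?_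
  rw [ENNReal.iSup_mul]
  refine iSup_le fun i => le_trans ?_ (le_iSup _ (max i j))
  exact mul_le_mul' (hf.1 (le_max_left _ _)) (hg.1 (le_max_right _ _))

lemma rpow {f : ℕ → ℝ≥0∞} {l : ℝ≥0∞} (hf : IncreasesTo f l) {e : ℝ} (he : 0 ≤ e) :
    IncreasesTo (fun n => f n ^ e) (l ^ e) := by
  have hm : Monotone fun n => f n ^ e := fun i j h => ENNReal.rpow_le_rpow (hf.1 h) he
  refine ⟨hm, tendsto_nhds_unique (tendsto_atTop_iSup hm) ?_⟩
  exact (ENNReal.continuous_rpow_const.tendsto l).comp (hf.2 ▸ tendsto_atTop_iSup hf.1)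

lemma setLIntegral {f : ℕ → ℝ → ℝ≥0∞} {l : ℝ → ℝ≥0∞} {s : Set ℝ} (hm : ∀ n, Measurable (f n))
    (hf : ∀ t, IncreasesTo (fun n => f n t) (l t)) :
    IncreasesTo (fun n => ∫⁻ t in s, f n t) (∫⁻ t in s, l t) := by
  refine ⟨fun i j h => lintegral_mono fun t => (hf t).1 h, ?_⟩
  rw [← lintegral_iSup hm fun i j h t => (hf t).1 h]
  exact lintegral_congr fun t => (hf t).2

lemma setLIntegral_Ioo_left {c : ℕ → ℝ} {a : ℝ} (hc : Antitone c) (hca : Tendsto c atTop (𝓝 a))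
    (g : ℝ → ℝ≥0∞) (t : ℝ) :
    IncreasesTo (fun n => ∫⁻ s in Ioo (c n) t, g s) (∫⁻ s in Ioo a t, g s) := by
  have hm : Monotone fun n => Ioo (c n) t := fun i j h => Ioo_subset_Ioo_left (hc h)
  refine ⟨fun i j h => lintegral_mono_set (hm h), ?_⟩
  rw [← setLIntegral_iUnion_of_directed g hm.directed_le]
  congr 2
  ext s
  simp only [mem_iUnion, mem_Ioo]
  refine ⟨fun ⟨n, h1, h2⟩ => ⟨(hc.le_of_tendsto hca n).trans_lt h1, h2⟩, fun ⟨h1, h2⟩ => ?_⟩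
  obtain ⟨n, hn⟩ := (hca.eventually_lt_const h1).exists
  exact ⟨n, hn, h2⟩

end IncreasesTo

/-- Truncation of `u` at height `n + 1`. -/
def truncation (n : ℕ) (u : ℝ → ℝ≥0∞) (t : ℝ) : ℝ≥0∞ := min (u t) (n + 1)

lemma truncation_le (n : ℕ) (u : ℝ → ℝ≥0∞) (t : ℝ) : truncation n u t ≤ u t := min_le_left _ _

lemma measurable_truncation {u : ℝ → ℝ≥0∞} (hu : Measurable u) (n : ℕ) :
    Measurable (truncation n u) := hu.min measurable_const

lemma increasesTo_truncation (u : ℝ → ℝ≥0∞) (t : ℝ) :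
    IncreasesTo (fun n => truncation n u t) (u t) := by
  have h : ⨆ n : ℕ, ((n : ℝ≥0∞) + 1) = ∞ :=
    top_le_iff.1 (ENNReal.iSup_natCast ▸ iSup_mono fun n => le_self_add)
  refine ⟨fun i j hij => min_le_min_left _ ?_, ?_⟩
  · gcongr
  · unfold truncation
    rw [← inf_iSup_eq, h, inf_top_eq]

lemma setLIntegral_Ioo_ne_top_of_le {a b : ℝ} {h : ℝ → ℝ≥0∞} {M : ℝ≥0∞}
    (hM : M ≠ ∞) (hle : ∀ t, h t ≤ M) : ∫⁻ t in Ioo a b, h t ≠ ∞ := by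
  refine ne_top_of_le_ne_top ?_ (lintegral_mono hle)
  rw [lintegral_const, Measure.restrict_apply_univ, Real.volume_Ioo]
  finiteness

lemma truncation_le_height (n : ℕ) (u : ℝ → ℝ≥0∞) (t : ℝ) : truncation n u t ≤ n + 1 :=
  min_le_right _ _

lemma setLIntegral_truncation_ne_top (n : ℕ) (u : ℝ → ℝ≥0∞) (a b : ℝ) :
    ∫⁻ t in Ioo a b, truncation n u t ≠ ∞ :=
  setLIntegral_Ioo_ne_top_of_le (by finiteness) (truncation_le_height n u)

lemma setLIntegral_truncation_rpow_ne_top (n : ℕ) (u : ℝ → ℝ≥0∞) (a b : ℝ) {e : ℝ} (he : 0 ≤ e) :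
    ∫⁻ t in Ioo a b, truncation n u t ^ e ≠ ∞ :=
  setLIntegral_Ioo_ne_top_of_le (M := (n + 1) ^ e) (by finiteness)
    fun t => ENNReal.rpow_le_rpow (truncation_le_height n u t) he

lemma setLIntegral_truncation_rpow_ne_zero {v : ℝ → ℝ≥0∞} (hv : Measurable v) {x t e : ℝ}
    (hxt : x < t) (hpos : ∀ s ∈ Ioo x t, 0 < v s) (n : ℕ) :
    ∫⁻ s in Ioo x t, truncation n v s ^ e ≠ 0 := by
  rw [← pos_iff_ne_zero, setLIntegral_pos_iff ((measurable_truncation hv n).pow_const _)]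
  refine lt_of_lt_of_le ?_ (measure_mono (s := Ioo x t) fun s hs => ⟨?_, hs⟩)
  · rw [Real.volume_Ioo]
    simpa using hxt
  · refine (ENNReal.rpow_pos (lt_min (hpos s hs) (by positivity)) ?_).ne'
    exact ne_top_of_le_ne_top (by finiteness) (min_le_right _ _)

lemma Vr_mono {r : ℝ} (hr0 : 0 < r) (hr1 : r < 1) {v v' : ℝ → ℝ≥0∞} (h : ∀ t, v t ≤ v' t)
    (x t : ℝ) : Vr r v x t ≤ Vr r v' x t := by
  have hr1' : 0 < 1 - r := by linarith
  rw [Vr_of_lt_one hr1, Vr_of_lt_one hr1]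
  gcongr with s
  exact h s

lemma increasesTo_Vr_truncation {r : ℝ} (hr0 : 0 < r) (hr1 : r < 1) {v : ℝ → ℝ≥0∞}
    (hv : Measurable v) (x t : ℝ) :
    IncreasesTo (fun n => Vr r (truncation n v) x t) (Vr r v x t) := by
  have hr1' : 0 < 1 - r := by linarith
  simp only [Vr_of_lt_one hr1]
  refine (IncreasesTo.setLIntegral (fun n => ?_) fun s => ?_).rpow (by positivity)
  · exact (measurable_truncation hv n).pow_const _
  · exact (increasesTo_truncation v s).rpow (by positivity)

lemma C₂_mono {a b p q r : ℝ} (hr0 : 0 < r) (hr1 : r < 1) (hq0 : 0 < q) (hq1 : q < 1)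
    {u u' v v' : ℝ → ℝ≥0∞} (w : ℝ → ℝ≥0∞) (hu : ∀ t, u t ≤ u' t) (hv : ∀ t, v t ≤ v' t) :
    C₂ a b r p q u v w ≤ C₂ a b r p q u' v' w := by
  have hq1' : 0 < 1 - q := by linarith
  unfold C₂
  gcongr with x hx t s
  · exact hu s
  · exact hu t
  · exact Vr_mono hr0 hr1 hv x t

lemma C₃_mono {a b p q r : ℝ} (hr0 : 0 < r) (hr1 : r < 1) (hrp : r < p) (hq0 : 0 < q)
    {u u' v v' : ℝ → ℝ≥0∞} (w : ℝ → ℝ≥0∞) (hu : ∀ t, u t ≤ u' t) (hv : ∀ t, v t ≤ v' t) :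
    C₃ a b r p q u v w ≤ C₃ a b r p q u' v' w := by
  have hpr : 0 < p - r := by linarith
  have hp0 : 0 < p := by linarith
  unfold C₃
  gcongr with x hx t t
  · exact hu t
  · exact Vr_mono hr0 hr1 hv t x

lemma CesCesIneq.mono {a b p q r : ℝ} (hr0 : 0 < r) (hq0 : 0 < q)
    {u u' v v' w : ℝ → ℝ≥0∞} {C : ℝ≥0∞} (hu : ∀ t, u t ≤ u' t) (hv : ∀ t, v t ≤ v' t)
    (h : CesCesIneq a b r p q u' v' w C) : CesCesIneq a b r p q u v w C := by
  intro f hf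
  refine le_trans ?_ (h f hf)
  gcongr with t s
  · exact hv s
  · exact hu t

lemma sufficiency_exists (p q r : ℝ) (hr0 : 0 < r) (hrp : r < p) (hpq : p ≤ q) (hq1 : q < 1) :
    ∃ K : ℝ≥0∞, K ≠ ∞ ∧ ∀ (a b : ℝ), a < b → ∀ u v w : ℝ → ℝ≥0∞,
      Measurable u → IsWeight a b v → Measurable w →
      (∀ x ∈ Ioo a b, ∫⁻ s in Ioo x b, w s ≠ 0) → (∀ x ∈ Ioo a b, ∫⁻ s in Ioo x b, w s ≠ ∞) →
      CesCesIneq a b r p q u v w (K * (C₂ a b r p q u v w + C₃ a b r p q u v w)) := by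
  have hr1 : r < 1 := by linarith
  have hr1' : 0 < 1 - r := by linarith
  have hq0 : 0 < q := by linarith
  have hp0 : 0 < p := by linarith
  obtain ⟨K, hK, hcore⟩ := sufficiency_truncated_exists p q r hr0 hrp hpq hq1
  refine ⟨K ^ (1 / q), by finiteness, fun a b hab u v w hu hv hw hw0 hwt f hf => ?_⟩
  set D := C₂ a b r p q u v w + C₃ a b r p q u v w with hD
  set R := ∫⁻ t in Ioo a b, (∫⁻ s in Ioo a t, f s) ^ p * w t with hR
  have htrunc : ∀ n : ℕ, ∀ c ∈ Ioo a b, ∫⁻ t in Ioo c b, truncation n u t *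
      (∫⁻ s in Ioo c t, truncation n f s ^ r * truncation n v s) ^ (q / r) ≤
        K * (D ^ q * R ^ (q / p)) := by
    intro n c hc
    refine (hcore a b (truncation n u) (truncation n v) w (truncation n f)
      (measurable_truncation hu n) (measurable_truncation hv.1 n) hw (measurable_truncation hf n)
      (setLIntegral_truncation_ne_top n u a b)
      (setLIntegral_truncation_rpow_ne_top n v a b (by positivity)) hw0 hwt (fun x hx t ht => ?_)
      c hc ?_).trans ?_
    · exact setLIntegral_truncation_rpow_ne_zero hv.1 ht.1
        (fun s hs => (hv.2 s ⟨hx.1.trans hs.1, hs.2.trans ht.2⟩).1) n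
    · exact setLIntegral_Ioo_ne_top_of_le (M := (n + 1) ^ r * (n + 1)) (by finiteness) fun t =>
        mul_le_mul' (ENNReal.rpow_le_rpow (truncation_le_height n f t) hr0.le)
          (truncation_le_height n v t)
    · refine mul_le_mul_right (mul_le_mul' (ENNReal.rpow_le_rpow (add_le_add ?_ ?_) hq0.le)
        (ENNReal.rpow_le_rpow ?_ (by positivity))) _
      · exact C₂_mono hr0 hr1 hq0 hq1 w (truncation_le n u) (truncation_le n v)
      · exact C₃_mono hr0 hr1 hrp hq0 w (truncation_le n u) (truncation_le n v)
      · refine (lintegral_mono fun t => ?_).trans (lintegral_mono_set (Ioo_subset_Ioo_left hc.1.le))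
        refine mul_le_mul_left (ENNReal.rpow_le_rpow ?_ hp0.le) _
        exact (lintegral_mono (truncation_le n f)).trans
          (lintegral_mono_set (Ioo_subset_Ioo_left hc.1.le))
  have hleft : ∀ c ∈ Ioo a b, ∫⁻ t in Ioo c b, u t *
      (∫⁻ s in Ioo c t, f s ^ r * v s) ^ (q / r) ≤ K * (D ^ q * R ^ (q / p)) := by
    intro c hc
    have hgm : ∀ n, Measurable fun s => truncation n f s ^ r * truncation n v s := fun n =>
      ((measurable_truncation hf n).pow_const _).mul (measurable_truncation hv.1 n)
    refine IncreasesTo.le_of_forall_le (IncreasesTo.setLIntegral (fun n => ?_) fun t => ?_)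
      fun n => htrunc n c hc
    · exact (measurable_truncation hu n).mul ((measurable_primitive _ _).pow_const _)
    · refine (increasesTo_truncation u t).mul
        ((IncreasesTo.setLIntegral hgm fun s => ?_).rpow (by positivity))
      exact ((increasesTo_truncation f s).rpow hr0.le).mul (increasesTo_truncation v s)
  have hfull : ∫⁻ t in Ioo a b, (∫⁻ s in Ioo a t, f s ^ r * v s) ^ (q / r) * u t ≤
      K * (D ^ q * R ^ (q / p)) := by
    obtain ⟨c, hc, hcm, hca⟩ := exists_seq_strictAnti_tendsto' hab
    refine IncreasesTo.le_of_forall_le (IncreasesTo.setLIntegral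
      (f := fun n t => (∫⁻ s in Ioo (c n) t, f s ^ r * v s) ^ (q / r) * u t) (fun n => ?_)
      fun t => ?_) fun n => ?_
    · exact ((measurable_primitive _ _).pow_const _).mul hu
    · exact ((IncreasesTo.setLIntegral_Ioo_left hc.antitone hca _ t).rpow (by positivity)).mul
        (IncreasesTo.const _)
    · refine le_trans ?_ (hleft (c n) (hcm n))
      have h0 : ∫⁻ t in Ioo a (c n), (∫⁻ s in Ioo (c n) t, f s ^ r * v s) ^ (q / r) * u t = 0 := by
        rw [← lintegral_zero (μ := volume.restrict (Ioo a (c n)))]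
        refine setLIntegral_congr_fun measurableSet_Ioo fun t ht => ?_
        rw [Ioo_eq_empty (not_lt.2 ht.2.le), Measure.restrict_empty, lintegral_zero_measure,
          ENNReal.zero_rpow_of_pos (by positivity), zero_mul]
      rw [setLIntegral_Ioo_add _ (hcm n).1.le (hcm n).2.le, h0, zero_add]
      exact (lintegral_congr fun t => mul_comm _ _).le
  calc _ ≤ (K * (D ^ q * R ^ (q / p))) ^ (1 / q) := ENNReal.rpow_le_rpow hfull (by positivity)
    _ = _ := by
      rw [ENNReal.mul_rpow_of_nonneg _ _ (by positivity),
        ENNReal.mul_rpow_of_nonneg _ _ (by positivity),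
        rpow_rpow_of_mul D (c := 1) (by field_simp), ENNReal.rpow_one,
        rpow_rpow_of_mul R (c := 1 / p) (by field_simp), mul_assoc]

lemma necessity_exists (p q r : ℝ) (hr0 : 0 < r) (hrp : r < p) (hpq : p ≤ q) (hq1 : q < 1) :
    ∃ K : ℝ≥0∞, K ≠ ∞ ∧ ∀ (a b : ℝ) (u v w : ℝ → ℝ≥0∞) (C : ℝ≥0∞),
      Measurable u → Measurable v → Measurable w →
      (∀ x ∈ Ioo a b, ∫⁻ s in Ioo x b, w s ≠ 0) → (∀ x ∈ Ioo a b, ∫⁻ s in Ioo x b, w s ≠ ∞) →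
      CesCesIneq a b r p q u v w C →
      C₂ a b r p q u v w + C₃ a b r p q u v w ≤ K * C := by
  have hr1 : r < 1 := by linarith
  have hr1' : 0 < 1 - r := by linarith
  have hq1' : 0 < 1 - q := by linarith
  have hq0 : 0 < q := by linarith
  have hp0 : 0 < p := by linarith
  have hpr : 0 < p - r := by linarith
  obtain ⟨K₁, hK₁, hleft⟩ := necessity_left_exists p q r hr0 hrp hpq hq1
  obtain ⟨K₂, hK₂, hright⟩ := necessity_right_exists p q r hr0 hrp hpq hq1
  refine ⟨K₁ + K₂, by finiteness, fun a b u v w C hu hv hw hw0 hwt hC => ?_⟩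
  have hCn : ∀ n, CesCesIneq a b r p q (truncation n u) (truncation n v) w C := fun n =>
    hC.mono hr0 hq0 (truncation_le n u) (truncation_le n v)
  have hun := fun n => measurable_truncation hu n
  have hvn := fun n => measurable_truncation hv n
  have hUinc : ∀ t, IncreasesTo (fun n => ∫⁻ s in Ioo t b, truncation n u s)
      (∫⁻ s in Ioo t b, u s) := fun t =>
    IncreasesTo.setLIntegral hun (increasesTo_truncation u)
  rw [add_mul]
  refine add_le_add (iSup₂_le fun x hx => ?_) (iSup₂_le fun x hx => ?_)
  · refine IncreasesTo.le_of_forall_le ((IncreasesTo.const _).mul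
      ((IncreasesTo.setLIntegral (fun n => ?_) fun t => ?_).rpow (by positivity))) fun n =>
      hleft a b (truncation n u) (truncation n v) w C (hun n) (hvn n) hw
        (setLIntegral_truncation_ne_top n u a b)
        (setLIntegral_truncation_rpow_ne_top n v a b (by positivity)) (hCn n) x hx
        (hw0 x hx) (hwt x hx)
    · simp only [Vr_of_lt_one hr1]
      exact (((measurable_tail _ _).pow_const _).mul (hun n)).mul
        (((measurable_primitive _ _).pow_const _).pow_const _)
    · exact (((hUinc t).rpow (by positivity)).mul (increasesTo_truncation u t)).mul
        ((increasesTo_Vr_truncation hr0 hr1 hv x t).rpow (by positivity))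
  · refine IncreasesTo.le_of_forall_le (((hUinc x).rpow (by positivity)).mul
      ((IncreasesTo.setLIntegral (fun n => ?_) fun t => ?_).rpow (by positivity))) fun n =>
      hright a b (truncation n u) (truncation n v) w C (hun n) (hvn n) hw
        (setLIntegral_truncation_rpow_ne_top n v a b (by positivity)) hw0 hwt (hCn n) x hx
    · simp only [Vr_of_lt_one hr1]
      exact (((measurable_tail _ _).pow_const _).mul hw).mul
        (((measurable_tail _ _).pow_const _).pow_const _)
    · exact (IncreasesTo.const _).mul
        ((increasesTo_Vr_truncation hr0 hr1 hv t x).rpow (by positivity))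

/-- case (iv) of the main theorem: for `r < p ≤ q < 1`,
the inequality holds iff `C₂ < ∞` and `C₃ < ∞`, and `C ≈ C₂ + C₃`. -/
theorem main_case_iv (p q r : ℝ) (hr0 : 0 < r) (hrp : r < p) (hpq : p ≤ q) (hq1 : q < 1) :
    ∃ κ₁ κ₂ : ℝ≥0∞, 0 < κ₁ ∧ κ₂ < ∞ ∧
    ∀ (a b : ℝ), a < b → ∀ u v w : ℝ → ℝ≥0∞,
      IsWeight a b u → IsWeight a b v → IsWeight a b w →
      (∀ x ∈ Set.Ioo a b,
        0 < (∫⁻ t in Set.Ioo x b, w t) ∧ (∫⁻ t in Set.Ioo x b, w t) < ∞) →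
      (((∃ C : ℝ≥0∞, C < ∞ ∧ CesCesIneq a b r p q u v w C) ↔
          (C₂ a b r p q u v w < ∞ ∧ C₃ a b r p q u v w < ∞)) ∧
        κ₁ * (C₂ a b r p q u v w + C₃ a b r p q u v w) ≤ BestC a b r p q u v w ∧
        BestC a b r p q u v w ≤ κ₂ * (C₂ a b r p q u v w + C₃ a b r p q u v w)) := by
  obtain ⟨K₁, hK₁, hnec⟩ := necessity_exists p q r hr0 hrp hpq hq1
  obtain ⟨K₂, hK₂, hsuf⟩ := sufficiency_exists p q r hr0 hrp hpq hq1
  refine ⟨K₁⁻¹, K₂, ENNReal.inv_pos.2 hK₁, hK₂.lt_top, fun a b hab u v w hu hv hw hW => ?_⟩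
  have hw0 : ∀ x ∈ Ioo a b, ∫⁻ s in Ioo x b, w s ≠ 0 := fun x hx => (hW x hx).1.ne'
  have hwt : ∀ x ∈ Ioo a b, ∫⁻ s in Ioo x b, w s ≠ ∞ := fun x hx => (hW x hx).2.ne
  have hnec' : ∀ C, CesCesIneq a b r p q u v w C →
      C₂ a b r p q u v w + C₃ a b r p q u v w ≤ K₁ * C :=
    fun C hC => hnec a b u v w C hu.1 hv.1 hw.1 hw0 hwt hC
  have hsuf' := hsuf a b hab u v w hu.1 hv hw.1 hw0 hwt
  refine ⟨⟨fun ⟨C, hCt, hC⟩ => ?_, fun ⟨h2, h3⟩ => ⟨_, ?_, hsuf'⟩⟩, ?_, sInf_le hsuf'⟩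
  · exact ENNReal.add_lt_top.1 ((hnec' C hC).trans_lt (ENNReal.mul_lt_top hK₁.lt_top hCt))
  · exact ENNReal.mul_lt_top hK₂.lt_top (ENNReal.add_lt_top.2 ⟨h2, h3⟩)
  · refine le_sInf fun C hC => ?_
    rw [← ENNReal.div_eq_inv_mul]
    exact ENNReal.div_le_of_le_mul' (hnec' C hC)
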